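/- arXiv:1501.06756 — 3 statements merged into one kernel-verified Lean document; each statement's English description precedes it below -/
import Mathlib

section
/- Let n ≥ 2. Any trace on the affine Temperley–Lieb algebra TL̂_{n+1}(q) is uniquely determined by its values on Markov elements: if τ and τ' are traces on TL̂_{n+1}(q) with τ(M) = τ'(M) for every Markov element M, then τ = τ'. -/
open FreeAlgebra

/-- `V(x,y) = x y x + x y + y x + x + y + 1`. -/
def Vel {R : Type*} [Ring R] (x y : R) : R :=
  x * y * x + x * y + y * x + x + y + 1

/-- Defining relations of the affine Temperley–Lieb algebra `TL̂_{n+1}(q)` of type `Ã_n`.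
Generators are indexed by `Fin (n+1)`: for `i < n` the index `i` stands for `g_{σ_{i+1}}`,
and the index `n` (i.e. `Fin.last n`) stands for `g_{a_{n+1}}`.  For `n = 1` only the
quadratic relations remain, so `TLhat K q 1` is `TL̂_2(q)` (with generators
`t_{σ_1} = g 0` and `t_{a_2} = g 1`). -/
inductive ATLRel (K : Type*) [CommRing K] (q : K) (n : ℕ) :
    FreeAlgebra K (Fin (n + 1)) → FreeAlgebra K (Fin (n + 1)) → Prop
  | quad (i : Fin (n + 1)) :
      ATLRel K q n (ι K i * ι K i) ((q - 1) • ι K i + algebraMap K _ q)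
  | comm_ss (i j : Fin (n + 1)) (hi : (i : ℕ) < n) (hj : (j : ℕ) < n)
      (hd : 2 ≤ Nat.dist (i : ℕ) (j : ℕ)) :
      ATLRel K q n (ι K i * ι K j) (ι K j * ι K i)
  | comm_sa (hn : 2 ≤ n) (i : Fin (n + 1)) (h1 : 1 ≤ (i : ℕ)) (h2 : (i : ℕ) + 2 ≤ n) :
      ATLRel K q n (ι K i * ι K (Fin.last n)) (ι K (Fin.last n) * ι K i)
  | braid_ss (i j : Fin (n + 1)) (hj : (j : ℕ) < n) (hij : (j : ℕ) = (i : ℕ) + 1) :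
      ATLRel K q n (ι K i * ι K j * ι K i) (ι K j * ι K i * ι K j)
  | braid_sa (hn : 2 ≤ n) (i : Fin (n + 1)) (h : (i : ℕ) = 0 ∨ (i : ℕ) + 1 = n) :
      ATLRel K q n (ι K i * ι K (Fin.last n) * ι K i)
        (ι K (Fin.last n) * ι K i * ι K (Fin.last n))
  | v_ss (i j : Fin (n + 1)) (hj : (j : ℕ) < n) (hij : (j : ℕ) = (i : ℕ) + 1) :
      ATLRel K q n (Vel (ι K i) (ι K j)) 0
  | v_s1a (hn : 2 ≤ n) (i : Fin (n + 1)) (hi : (i : ℕ) = 0) :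
      ATLRel K q n (Vel (ι K i) (ι K (Fin.last n))) 0
  | v_sna (hn : 2 ≤ n) (i : Fin (n + 1)) (hi : (i : ℕ) + 1 = n) :
      ATLRel K q n (Vel (ι K i) (ι K (Fin.last n))) 0

/-- The affine Temperley–Lieb algebra `TL̂_{n+1}(q)`. -/
abbrev TLhat (K : Type*) [CommRing K] (q : K) (n : ℕ) :=
  RingQuot (ATLRel K q n)

/-- Defining relations of the type `A` Temperley–Lieb algebra `TL_n(q)` with `n`
generators `g_{σ_1}, …, g_{σ_n}`; index `i : Fin n` stands for `g_{σ_{i+1}}`. -/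
inductive TLARel (K : Type*) [CommRing K] (q : K) (n : ℕ) :
    FreeAlgebra K (Fin n) → FreeAlgebra K (Fin n) → Prop
  | quad (i : Fin n) :
      TLARel K q n (ι K i * ι K i) ((q - 1) • ι K i + algebraMap K _ q)
  | comm (i j : Fin n) (hd : 2 ≤ Nat.dist (i : ℕ) (j : ℕ)) :
      TLARel K q n (ι K i * ι K j) (ι K j * ι K i)
  | braid (i j : Fin n) (hij : (j : ℕ) = (i : ℕ) + 1) :
      TLARel K q n (ι K i * ι K j * ι K i) (ι K j * ι K i * ι K j)
  | vrel (i j : Fin n) (hij : (j : ℕ) = (i : ℕ) + 1) :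
      TLARel K q n (Vel (ι K i) (ι K j)) 0

/-- The Temperley–Lieb algebra `TL_n(q)` of type `A` (abstract presentation). -/
abbrev TLA (K : Type*) [CommRing K] (q : K) (n : ℕ) :=
  RingQuot (TLARel K q n)

variable (K : Type*) [CommRing K] (q : K) (n : ℕ)

/-- The generator `g_i` of `TL̂_{n+1}(q)`. -/
noncomputable def gg (i : Fin (n + 1)) : TLhat K q n :=
  RingQuot.mkAlgHom K (ATLRel K q n) (ι K i)

/-- The inverse `q⁻¹ (g_i - (q-1))` of the generator `g_i` of `TL̂_{n+1}(q)`. -/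
noncomputable def ggInv [Invertible q] (i : Fin (n + 1)) : TLhat K q n :=
  ⅟q • (gg K q n i - algebraMap K _ (q - 1))

/-- The generator `g_{σ_{i+1}}` of `TL_n(q)`. -/
noncomputable def ga (i : Fin n) : TLA K q n :=
  RingQuot.mkAlgHom K (TLARel K q n) (ι K i)

/-- The inverse `q⁻¹ (g - (q-1))` of a generator of `TL_n(q)`. -/
noncomputable def gaInv [Invertible q] (i : Fin n) : TLA K q n :=
  ⅟q • (ga K q n i - algebraMap K _ (q - 1))

/-- The index of `g_{σ_n}` in `TL̂_{n+1}(q)`. -/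
def sigmaTop : Fin (n + 1) := ⟨n - 1, Nat.lt_succ_of_le (Nat.sub_le n 1)⟩

/-- The index of `g_{σ_{n-1}}` in `TL̂_{n+1}(q)`. -/
def sigmaSub : Fin (n + 1) := ⟨n - 2, Nat.lt_succ_of_le (Nat.sub_le n 2)⟩

/-- `F` is the canonical homomorphism `F_n : TL̂_n(q) → TL̂_{n+1}(q)`, determined by
`t_{σ_i} ↦ g_{σ_i}` for `1 ≤ i ≤ n-1` and `t_{a_n} ↦ g_{σ_n} g_{a_{n+1}} g_{σ_n}⁻¹`. -/
def IsF [Invertible q] (F : TLhat K q (n - 1) →ₐ[K] TLhat K q n) : Prop :=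
  (∀ i : Fin (n - 1 + 1), (i : ℕ) < n - 1 →
      F (gg K q (n - 1) i) =
        gg K q n (Fin.castLE (Nat.succ_le_succ (Nat.sub_le n 1)) i)) ∧
  F (gg K q (n - 1) (Fin.last (n - 1))) =
    gg K q n (sigmaTop n) * gg K q n (Fin.last n) * ggInv K q n (sigmaTop n)

/-- Markov elements: `A g_{σ_n}^ε B` with `A, B` in the image of `F_n` and `ε ∈ {0,1}`. -/
def IsMarkov [Invertible q] (F : TLhat K q (n - 1) →ₐ[K] TLhat K q n)
    (x : TLhat K q n) : Prop :=
  ∃ A B : TLhat K q (n - 1), ∃ ε : ℕ, ε ≤ 1 ∧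
    x = F A * gg K q n (sigmaTop n) ^ ε * F B

/-- A trace on a `K`-algebra `R`: a `K`-linear map with `τ(xy) = τ(yx)`. -/
def IsTrace {R : Type*} [Ring R] [Algebra K R] (τ : R →ₗ[K] K) : Prop :=
  ∀ x y : R, τ (x * y) = τ (y * x)

/-- The Dynkin automorphism `ψ` of `TL̂_{n+1}(q)`: `g_i ↦ g_{i+1}` cyclically, i.e.
`g_{σ_1} ↦ g_{σ_2} ↦ ⋯ ↦ g_{σ_n} ↦ g_{a_{n+1}} ↦ g_{σ_1}`. -/
def IsDynkin (ψ : TLhat K q n ≃ₐ[K] TLhat K q n) : Prop :=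
  ∀ i : Fin (n + 1), ψ (gg K q n i) = gg K q n (i + 1)

/-- `X = g_{σ_n} g_{σ_{n-1}} ⋯ g_{σ_1} g_{a_{n+1}}`. -/
noncomputable def Xel : TLhat K q n :=
  (List.ofFn fun t : Fin n =>
      gg K q n ⟨n - 1 - (t : ℕ),
        Nat.lt_succ_of_le (le_trans (Nat.sub_le _ _) (Nat.sub_le _ _))⟩).prod *
    gg K q n (Fin.last n)

/-- `Z = g_{σ_{n-1}} g_{σ_{n-2}} ⋯ g_{σ_1} · F_n(t_{a_n})`. -/
noncomputable def Zel [Invertible q] (F : TLhat K q (n - 1) →ₐ[K] TLhat K q n) :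
    TLhat K q n :=
  (List.ofFn fun t : Fin (n - 1) =>
      gg K q n ⟨n - 2 - (t : ℕ),
        Nat.lt_succ_of_le (le_trans (Nat.sub_le _ _) (Nat.sub_le _ _))⟩).prod *
    F (gg K q (n - 1) (Fin.last (n - 1)))

/-- `g_{σ_n} g_{σ_{n-1}} ⋯ g_{σ_i}`, with the convention that it is `1` when `i = n + 1`. -/
noncomputable def tailChain (i : ℕ) : TLhat K q n :=
  (List.ofFn fun t : Fin (n + 1 - i) =>
      gg K q n ⟨n - 1 - (t : ℕ),
        Nat.lt_succ_of_le (le_trans (Nat.sub_le _ _) (Nat.sub_le _ _))⟩).prod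

/-- `g_{σ_{i₀}} g_{σ_{i₀ - 1}} ⋯ g_{σ_1}`, with the convention that it is `1` when `i₀ = 0`. -/
noncomputable def headChain (i₀ : ℕ) (h : i₀ ≤ n) : TLhat K q n :=
  (List.ofFn fun t : Fin i₀ =>
      gg K q n ⟨i₀ - 1 - (t : ℕ),
        Nat.lt_succ_of_le (le_trans (le_trans (Nat.sub_le _ _) (Nat.sub_le _ _)) h)⟩).prod

/-- `TL_n(q)` realized as the subalgebra of `TL̂_{n+1}(q)` generated by `g_{σ_1}, …, g_{σ_n}`. -/
noncomputable def TLsub : Subalgebra K (TLhat K q n) :=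
  Algebra.adjoin K (Set.range fun i : Fin n => gg K q n (Fin.castSucc i))

/-- The generator `g_{σ_{i+1}}` as an element of the subalgebra `TL_n(q)`. -/
noncomputable def sgen (i : Fin n) : TLsub K q n :=
  ⟨gg K q n (Fin.castSucc i), Algebra.subset_adjoin (Set.mem_range_self i)⟩

/-- The inverse `q⁻¹ (g - (q-1))` of `sgen` inside `TL_n(q)`. -/
noncomputable def sgenInv [Invertible q] (i : Fin n) : TLsub K q n :=
  ⅟q • (sgen K q n i - algebraMap K _ (q - 1))

/-- `g_{σ_1} ⋯ g_{σ_{n-1}} g_{σ_n} g_{σ_{n-1}}⁻¹ ⋯ g_{σ_1}⁻¹` in `TL̂_{n+1}(q)`. -/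
noncomputable def EnTarget [Invertible q] : TLhat K q n :=
  (List.ofFn fun t : Fin (n - 1) =>
      gg K q n (Fin.castLE (le_trans (Nat.sub_le n 1) (Nat.le_succ n)) t)).prod *
    gg K q n (sigmaTop n) *
    (List.ofFn fun t : Fin (n - 1) =>
      ggInv K q n ⟨n - 2 - (t : ℕ),
        Nat.lt_succ_of_le (le_trans (Nat.sub_le _ _) (Nat.sub_le _ _))⟩).prod

/-- `E` is the canonical homomorphism `E_n : TL̂_{n+1}(q) → TL_n(q)`, determined by
`g_{σ_i} ↦ g_{σ_i}` for `1 ≤ i ≤ n` and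
`g_{a_{n+1}} ↦ g_{σ_1} ⋯ g_{σ_{n-1}} g_{σ_n} g_{σ_{n-1}}⁻¹ ⋯ g_{σ_1}⁻¹`. -/
def IsE [Invertible q] (E : TLhat K q n →ₐ[K] TLsub K q n) : Prop :=
  (∀ i : Fin n,
    (E (gg K q n (Fin.castSucc i)) : TLhat K q n) = gg K q n (Fin.castSucc i)) ∧
  (E (gg K q n (Fin.last n)) : TLhat K q n) = EnTarget K q n

/-- A family of Temperley–Lieb generators with loop parameter `δ`, indexed by the integers
modulo `N`. -/
structure IsCyclicTL {𝕜 A : Type*} [CommRing 𝕜] [Ring A] [Algebra 𝕜 A]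
    (N : ℤ) (δ : 𝕜) (e : ℤ → A) : Prop where
  sq : ∀ i, e i * e i = δ • e i
  per : ∀ i, e (i + N) = e i
  up : ∀ i, e i * e (i + 1) * e i = e i
  down : ∀ i, e (i + 1) * e i * e (i + 1) = e (i + 1)
  comm : ∀ i j, i + 2 ≤ j → j ≤ i + N - 2 → e i * e j = e j * e i

/-- A family `c` on which the generators adjacent to the index act by shifting it. -/
structure IsSpiral {A : Type*} [Mul A] (e c : ℤ → A) : Prop where
  up : ∀ i, c (i + 1) = e (i + 1) * c i
  down : ∀ i, c i = e i * c (i + 1)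

/-- The spiral `… , e₋₁ e₀, e₀, e₁ e₀, e₂ e₁ e₀, …`. -/
def spiral {A : Type*} [Mul A] (e : ℤ → A) : ℤ → A
  | .ofNat k => Nat.rec (e 0) (fun k x => e (k + 1) * x) k
  | .negSucc k => Nat.rec (e (-1) * e 0) (fun k x => e (-(k + 2)) * x) k

section

variable {𝕜 A : Type*} [CommRing 𝕜] [Ring A] [Algebra 𝕜 A] {N : ℤ} {δ s t : 𝕜} {e c ε : ℤ → A}

lemma spiral_zero (e : ℤ → A) : spiral e 0 = e 0 := rfl

lemma spiral_succ (e : ℤ → A) (k : ℕ) : spiral e (k + 1) = e (k + 1) * spiral e k := rfl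

lemma spiral_neg_one (e : ℤ → A) : spiral e (-1) = e (-1) * e 0 := rfl

lemma spiral_neg_succ (e : ℤ → A) (k : ℕ) :
    spiral e (-(k + 1)) = e (-(k + 1)) * spiral e (-k) := by
  rcases k with _ | k
  · exact spiral_neg_one e
  · have h1 : (-((k + 1 : ℕ) + 1) : ℤ) = .negSucc (k + 1) := by
      rw [Int.negSucc_eq]
    have h2 : (-((k + 1 : ℕ) : ℤ)) = .negSucc k := by
      rw [Int.negSucc_eq]; push_cast; rfl
    rw [h2, h1]
    change e (-(k + 2)) * _ = _
    congr 2

namespace IsCyclicTL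

lemma per_mul (he : IsCyclicTL N δ e) (i k : ℤ) : e (i + N * k) = e i := by
  induction k using Int.induction_on with
  | zero => simp
  | succ k ih => rw [← ih, ← he.per (i + N * k)]; congr 1; ring
  | pred k ih => rw [← ih, ← he.per (i + N * (-k - 1))]; congr 1; ring

lemma isSpiral_spiral (he : IsCyclicTL N δ e) : IsSpiral e (spiral e) := by
  have hleft (i : ℤ) : ∃ y, spiral e i = e i * y := by
    rcases lt_or_ge i 0 with hi | hi
    · obtain ⟨k, rfl⟩ : ∃ k : ℕ, i = -(k + 1) := ⟨(-i - 1).toNat, by omega⟩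
      exact ⟨_, spiral_neg_succ e k⟩
    · obtain ⟨k, rfl⟩ := Int.eq_ofNat_of_zero_le hi
      rcases k with _ | k
      · exact ⟨1, by simp [spiral_zero]⟩
      · exact ⟨_, by exact_mod_cast spiral_succ e k⟩
  constructor
  · intro i
    rcases lt_or_ge i 0 with hi | hi
    · obtain ⟨k, rfl⟩ : ∃ k : ℕ, i = -(k + 1) := ⟨(-i - 1).toNat, by omega⟩
      obtain ⟨y, hy⟩ := hleft (-k)
      have h := he.down (-(k + 1))
      rw [show -((k : ℤ) + 1) + 1 = -k by ring] at h ⊢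
      rw [spiral_neg_succ, hy, ← mul_assoc, ← mul_assoc, h]
    · obtain ⟨k, rfl⟩ := Int.eq_ofNat_of_zero_le hi
      exact spiral_succ e k
  · intro i
    rcases lt_or_ge i 0 with hi | hi
    · obtain ⟨k, rfl⟩ : ∃ k : ℕ, i = -(k + 1) := ⟨(-i - 1).toNat, by omega⟩
      rw [spiral_neg_succ, show -((k : ℤ) + 1) + 1 = -k by ring]
    · obtain ⟨k, rfl⟩ := Int.eq_ofNat_of_zero_le hi
      obtain ⟨y, hy⟩ := hleft k
      rw [spiral_succ, hy, ← mul_assoc, ← mul_assoc, he.up]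

lemma reflect (he : IsCyclicTL N δ e) : IsCyclicTL N δ (fun i => e (-i)) where
  sq i := he.sq _
  per i := by rw [← he.per (-(i + N))]; congr 1; ring
  up i := by
    have h := he.down (-(i + 1))
    rwa [show -(i + 1) + 1 = -i by ring] at h
  down i := by
    have h := he.up (-(i + 1))
    rwa [show -(i + 1) + 1 = -i by ring] at h
  comm i j h1 h2 := (he.comm (-j) (-i) (by omega) (by omega)).symm

end IsCyclicTL

namespace IsSpiral

lemma reflect (hc : IsSpiral e c) : IsSpiral (fun i => e (-i)) (fun i => c (-i)) where
  up i := by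
    have h := hc.down (-(i + 1))
    rwa [show -(i + 1) + 1 = -i by ring] at h
  down i := by
    have h := hc.up (-(i + 1))
    rwa [show -(i + 1) + 1 = -i by ring] at h

lemma left_smul (he : IsCyclicTL N δ e) (hc : IsSpiral e c) (i : ℤ) : e i * c i = δ • c i := by
  rw [hc.down, ← mul_assoc, he.sq, smul_mul_assoc]

lemma right_smul (he : IsCyclicTL N δ e) (hc : IsSpiral e c) (h0 : c 0 = e 0) (i : ℤ) :
    c i * e 0 = δ • c i := by
  induction i using Int.induction_on with
  | zero => rw [h0, he.sq]
  | succ k ih => rw [hc.up, mul_assoc, ih, mul_smul_comm]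
  | pred k ih => rw [hc.down, sub_add_cancel, mul_assoc, ih, mul_smul_comm]

end IsSpiral

/-- `e j` either sends `c i` to a multiple of a member of the spiral, or `j` is not adjacent
to `i` modulo `N`. -/
lemma IsSpiral.left_mul (he : IsCyclicTL N δ e) (hc : IsSpiral e c) (hN : 0 < N) (i j : ℤ) :
    (∃ (r : 𝕜) (i' : ℤ), e j * c i = r • c i') ∨
      ∃ j', i + 2 ≤ j' ∧ j' ≤ i + N - 2 ∧ e j = e j' := by
  have h2 := Int.emod_nonneg (j - i + 1) hN.ne'
  have h3 := Int.emod_lt_of_pos (j - i + 1) hN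
  have h4 := Int.emod_add_mul_ediv (j - i + 1) N
  set k := (j - i + 1) / N
  set r := (j - i + 1) % N
  have hj : e j = e (i + r - 1) := by
    rw [← he.per_mul (i + r - 1) k]; congr 1; linarith
  rw [hj]
  obtain h | h | h | h : r = 0 ∨ r = 1 ∨ r = 2 ∨ 3 ≤ r := by omega
  · have h5 := hc.down (i - 1)
    rw [sub_add_cancel] at h5
    exact .inl ⟨1, i - 1, by rw [h, add_zero, ← h5, one_smul]⟩
  · exact .inl ⟨δ, i, by rw [h, add_sub_cancel_right, hc.left_smul he]⟩
  · exact .inl ⟨1, i + 1, by rw [h, show i + 2 - 1 = i + 1 by ring, ← hc.up, one_smul]⟩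
  · exact .inr ⟨_, by omega, by omega, rfl⟩

/-- `e j` acts on the spiral away from its index as right multiplication by `ε j`. -/
structure IsTransverse {A : Type*} [Mul A] (N : ℤ) (e c ε : ℤ → A) : Prop where
  per : ∀ j, ε (j + (N - 2)) = ε j
  act : ∀ i j, i + 2 ≤ j → j ≤ i + N - 2 → e j * c i = c i * ε j

namespace IsTransverse

lemma per_mul (hε : IsTransverse N e c ε) (i k : ℤ) : ε (i + (N - 2) * k) = ε i := by
  induction k using Int.induction_on with
  | zero => simp
  | succ k ih => rw [← ih, ← hε.per (i + (N - 2) * k)]; congr 1; ring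
  | pred k ih => rw [← ih, ← hε.per (i + (N - 2) * (-k - 1))]; congr 1; ring

lemma reflect (he : IsCyclicTL N δ e) (hε : IsTransverse N e c ε) :
    IsTransverse N (fun i => e (-i)) (fun i => c (-i)) (fun j => ε (2 - j)) where
  per j := by
    rw [← hε.per (2 - (j + (N - 2)))]; congr 1; ring
  act i j h1 h2 := by
    have h := hε.act (-i) (-j + N) (by omega) (by omega)
    rw [he.per, show -j + N = 2 - j + (N - 2) by ring, hε.per] at h
    exact h

lemma of_base (he : IsCyclicTL N δ e) (hc : IsSpiral e c) (hN : 4 ≤ N)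
    (hper : ∀ j, ε (j + (N - 2)) = ε j)
    (hbase : ∀ j, 2 ≤ j → j ≤ N - 1 →
      ∃ i, i + 2 ≤ j ∧ j ≤ i + N - 2 ∧ e j * c i = c i * ε j) :
    IsTransverse N e c ε := by
  have window (j : ℤ) (h : ∃ i, i + 2 ≤ j ∧ j ≤ i + N - 2 ∧ e j * c i = c i * ε j) (i : ℤ)
      (h1 : i + 2 ≤ j) (h2 : j ≤ i + N - 2) : e j * c i = c i * ε j := by
    obtain ⟨i₀, h3, h4, h5⟩ := h
    rcases le_total i₀ i with hi | hi
    · induction i, hi using Int.leInduction with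
      | base => exact h5
      | succ i hi ih =>
        rw [hc.up, ← mul_assoc, ← he.comm _ _ h1 h2, mul_assoc, ih (by omega) (by omega),
          mul_assoc]
    · induction i, hi using Int.leInductionDown with
      | base => exact h5
      | pred i hi ih =>
        rw [hc.down, sub_add_cancel, ← mul_assoc, ← he.comm _ _ h1 h2, mul_assoc,
          ih (by omega) (by omega), mul_assoc]
  have shift (j : ℤ) : e (j - 2) * c j = e j * c (j - 2) := by
    have h1 := hc.up (j - 1)
    have h2 := hc.down (j - 2)
    rw [sub_add_cancel] at h1
    rw [show j - 2 + 1 = j - 1 by ring] at h2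
    rw [h1, h2, ← mul_assoc, ← mul_assoc, he.comm _ _ (by omega) (by omega)]
  have key (k : ℤ) : ∀ j, 2 ≤ j → j ≤ N - 1 →
      ∃ i, i + 2 ≤ j + (N - 2) * k ∧ j + (N - 2) * k ≤ i + N - 2 ∧
        e (j + (N - 2) * k) * c i = c i * ε (j + (N - 2) * k) := by
    induction k using Int.induction_on with
    | zero => simpa using hbase
    | succ k ih =>
      intro j h1 h2
      obtain h := window _ (ih j h1 h2)
      set l := j + (N - 2) * (k : ℤ) with hl
      have hl' : j + (N - 2) * ((k : ℤ) + 1) = l + (N - 2) := by rw [hl]; ring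
      rw [hl']
      refine ⟨l, by omega, by omega, ?_⟩
      have h3 := hc.up (l - 1)
      have h4 := hc.up (l - 2)
      rw [sub_add_cancel] at h3
      rw [show l - 2 + 1 = l - 1 by ring] at h4
      have h5 := he.down (l - 1)
      rw [sub_add_cancel] at h5
      rw [hper, show l + (N - 2) = l - 2 + N by ring, he.per, shift, h3, h4, mul_assoc, mul_assoc,
        ← h _ (by omega) (by omega), ← mul_assoc, ← mul_assoc, h5]
    | pred k ih =>
      intro j h1 h2
      obtain h := window _ (ih j h1 h2)
      set l := j + (N - 2) * (-(k : ℤ) - 1) with hl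
      have hl' : j + (N - 2) * (-(k : ℤ)) = l + (N - 2) := by rw [hl]; ring
      rw [hl'] at h
      refine ⟨l - 2, by omega, by omega, ?_⟩
      have h0 := h l (by omega) (by omega)
      rw [hper, show l + (N - 2) = l - 2 + N by ring, he.per] at h0
      have h3 := hc.down (l - 1)
      have h4 := hc.down (l - 2)
      rw [sub_add_cancel] at h3
      rw [show l - 2 + 1 = l - 1 by ring] at h4
      have h5 := he.up (l - 2)
      rw [show l - 2 + 1 = l - 1 by ring] at h5
      rw [← shift, h4, h3, mul_assoc, mul_assoc, ← h0, ← mul_assoc, ← mul_assoc, h5]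
  refine ⟨hper, fun i j h1 h2 => window j ?_ i h1 h2⟩
  have hpos : 0 < N - 2 := by omega
  have h3 := Int.emod_nonneg (j - 2) hpos.ne'
  have h4 := Int.emod_lt_of_pos (j - 2) hpos
  have h5 := Int.emod_add_mul_ediv (j - 2) (N - 2)
  have h := key ((j - 2) / (N - 2)) ((j - 2) % (N - 2) + 2) (by omega) (by omega)
  rwa [show (j - 2) % (N - 2) + 2 + (N - 2) * ((j - 2) / (N - 2)) = j by omega] at h

lemma shift (he : IsCyclicTL N δ e) (hc : IsSpiral e c) (hε : IsTransverse N e c ε)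
    (hN : 4 ≤ N) (i : ℤ) : c i * ε (i + 2) = c (i + 2) * ε (i + 2) := by
  rw [← hε.per (i + 2), ← hε.act (i + 2) (i + 2 + (N - 2)) (by omega) (by omega), hε.per,
    ← hε.act i (i + 2) (by omega) (by omega), show i + 2 + (N - 2) = i + N by ring, he.per,
    show i + 2 = i + 1 + 1 by ring, hc.up (i + 1), hc.down i, ← mul_assoc, ← mul_assoc,
    he.comm i (i + 1 + 1) (by omega) (by omega)]

lemma unwind (he : IsCyclicTL N δ e) (hc : IsSpiral e c) (hε : IsTransverse N e c ε)
    (hN : 4 ≤ N) {C : Subalgebra 𝕜 A} (hC : ∀ j, ε j ∈ C) (i : ℤ) (r : ℕ) (hr : r ≤ N - 4) :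
    ∃ x ∈ C, c i * ε (i + 2 + r) = c (i + 2 + r) * ε (i + 2) * x := by
  induction r with
  | zero => exact ⟨1, one_mem C, by simpa using hε.shift he hc hN i⟩
  | succ r ih =>
    push_cast at hr ⊢
    obtain ⟨x, hx, h⟩ := ih (by omega)
    refine ⟨x * ε (i + 2 + (r + 1)), mul_mem hx (hC _), ?_⟩
    have h1 := hε.act i (i + 2 + (r + 1)) (by omega) (by omega)
    have h2 := hε.act i (i + 2 + r) (by omega) (by omega)
    have h3 := he.down (i + 2 + r)
    have h4 := hc.up (i + 2 + r)
    rw [show i + 2 + (r : ℤ) + 1 = i + 2 + (r + 1) by ring] at h3 h4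
    calc c i * ε (i + 2 + (r + 1))
        = e (i + 2 + (r + 1)) * e (i + 2 + r) * e (i + 2 + (r + 1)) * c i := by rw [h3, h1]
      _ = e (i + 2 + (r + 1)) * (e (i + 2 + r) * c i) * ε (i + 2 + (r + 1)) := by
        rw [mul_assoc, h1]; simp only [mul_assoc]
      _ = _ := by rw [h2, h, h4]; simp only [mul_assoc]

lemma exists_larger (he : IsCyclicTL N δ e) (hc : IsSpiral e c) (hε : IsTransverse N e c ε)
    (hN : 4 ≤ N) {C : Subalgebra 𝕜 A} (hC : ∀ j, ε j ∈ C) (i k : ℤ) :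
    ∃ i' k', i < i' ∧ i' ≤ i + N ∧ ∃ x ∈ C, c i * ε k = c i' * ε k' * x := by
  have hpos : 0 < N - 2 := by omega
  have h3 := Int.emod_nonneg (k - i - 2) hpos.ne'
  have h4 := Int.emod_lt_of_pos (k - i - 2) hpos
  have h5 := Int.emod_add_mul_ediv (k - i - 2) (N - 2)
  obtain ⟨r, hr⟩ := Int.eq_ofNat_of_zero_le h3
  have hk : ε k = ε (i + 2 + r) := by
    rw [← hε.per_mul (i + 2 + r) ((k - i - 2) / (N - 2))]; congr 1; linarith
  rcases le_or_gt (r : ℤ) (N - 4) with h | h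
  · obtain ⟨x, hx, h6⟩ := hε.unwind he hc hN hC i r h
    exact ⟨i + 2 + r, i + 2, by omega, by omega, x, hx, by rw [hk, h6]⟩
  · obtain ⟨m, hm⟩ := Int.eq_ofNat_of_zero_le (show 0 ≤ N - 4 by omega)
    obtain ⟨x, hx, h6⟩ := hε.unwind he hc hN hC (i + 1) m (by omega)
    refine ⟨i + N, i + 1 + 2, by omega, by omega, x, hx, ?_⟩
    have h7 := hc.up (i + N - 1)
    rw [sub_add_cancel, he.per] at h7
    rw [hk, hc.down i, mul_assoc, show i + 2 + (r : ℤ) = i + 1 + 2 + m by omega, h6,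
      show i + 1 + 2 + (m : ℤ) = i + N - 1 by omega, h7]
    simp only [mul_assoc]

/-- If a right `C`-stable set contains all `c i * ε k` for `N` consecutive values of `i`, it
contains all of them. -/
lemma mem_of_window (he : IsCyclicTL N δ e) (hc : IsSpiral e c) (hε : IsTransverse N e c ε)
    (hN : 4 ≤ N) {C : Subalgebra 𝕜 A} (hC : ∀ j, ε j ∈ C) {G : Set A}
    (hG : ∀ y ∈ G, ∀ x ∈ C, y * x ∈ G) (a : ℤ)
    (hwin : ∀ i, a ≤ i → i < a + N → ∀ k, c i * ε k ∈ G) (i k : ℤ) : c i * ε k ∈ G := by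
  have below {e c ε : ℤ → A} (he : IsCyclicTL N δ e) (hc : IsSpiral e c)
      (hε : IsTransverse N e c ε) (hC : ∀ j, ε j ∈ C) (a : ℤ)
      (hwin : ∀ i, a ≤ i → i < a + N → ∀ k, c i * ε k ∈ G) (d : ℕ) :
      ∀ i, a - d ≤ i → i < a + N → ∀ k, c i * ε k ∈ G := by
    induction d with
    | zero => simpa using hwin
    | succ d ih =>
      intro i h1 h2 k
      rcases le_or_gt (a - d) i with h | h
      · exact ih i h h2 k
      · obtain ⟨i', k', h3, h4, x, hx, h5⟩ := hε.exists_larger he hc hN hC i k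
        rw [h5]
        push_cast at h1
        exact hG _ (ih i' (by omega) (by omega) k') x hx
  rcases le_or_gt a i with h | h
  · have h1 := below he.reflect hc.reflect (hε.reflect he) (fun j => hC _) (-(a + N - 1))
      (fun i h1 h2 k => hwin (-i) (by omega) (by omega) (2 - k)) (i - a).toNat (-i)
      (by omega) (by omega) (2 - k)
    simpa using h1
  · exact below he hc hε hC a hwin (a - i).toNat i (by omega) (by omega) k

end IsTransverse

section

variable {G : Submodule 𝕜 A} {Λ : Submodule 𝕜 A} {R : Subalgebra 𝕜 A}

lemma IsSpiral.mem_of_mem_of_window (he : IsCyclicTL N δ e) (hc : IsSpiral e c)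
    (hR : ∀ j, 2 ≤ j → j ≤ N - 1 → e j ∈ R) (hG : ∀ r ∈ R, ∀ x ∈ G, r * x ∈ G) {k i j : ℤ}
    (hi : 2 ≤ i) (hi' : i ≤ N - 1) (hj : 2 ≤ j) (hj' : j ≤ N - 1)
    (h : c (i + N * k) ∈ G) : c (j + N * k) ∈ G := by
  rcases le_total i j with hij | hij
  · induction j, hij using Int.leInduction with
    | base => exact h
    | succ j hij ih =>
      have h1 := hG _ (hR (j + 1) hj hj') _ (ih (by omega) (by omega))
      rwa [← he.per_mul _ k, show j + 1 + N * k = j + N * k + 1 by ring, ← hc.up,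
        show j + N * k + 1 = j + 1 + N * k by ring] at h1
  · induction j, hij using Int.leInductionDown with
    | base => exact h
    | pred j hij ih =>
      have h1 := hG _ (hR (j - 1) hj hj') _ (ih (by omega) (by omega))
      rwa [← he.per_mul _ k, show j + N * k = j - 1 + N * k + 1 by ring, ← hc.down] at h1

lemma IsSpiral.mem_and_sub_mem (hst : s * t = 1) (he : IsCyclicTL N δ e) (hc : IsSpiral e c)
    (hN : 3 ≤ N) (hR : ∀ j, 2 ≤ j → j ≤ N - 1 → e j ∈ R)
    (hh : (s • e 0 - 1) * e 1 * (t • e 0 - 1) ∈ R) (hG : ∀ r ∈ R, ∀ x ∈ G, r * x ∈ G)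
    (hΛ : Λ ≤ G) (hΛe : ∀ j, ∀ x ∈ Λ, e j * x ∈ Λ)
    (hΛc : ∀ i j, i + 2 ≤ j → j ≤ i + N - 2 → e j * c i ∈ Λ)
    (h0 : c (-1) ∈ G) (h1 : s • c 0 - c 1 ∈ G) (k : ℤ) :
    c (N * k - 1) ∈ G ∧ s • c (N * k) - c (N * k + 1) ∈ G := by
  have per0 (k : ℤ) : e 0 = e (N * k) := by rw [← he.per_mul 0 k, zero_add]
  have per1 (k : ℤ) : e 1 = e (N * k + 1) := by rw [← he.per_mul 1 k, add_comm]
  have a1 (k : ℤ) : e 0 * c (N * k - 1) = c (N * k) := by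
    have h := hc.up (N * k - 1)
    rw [sub_add_cancel] at h
    rw [per0 k, h]
  have a2 (k : ℤ) : e 0 * c (N * k + 1) = c (N * k) := by rw [per0 k, ← hc.down]
  have a3 (k : ℤ) : e 1 * c (N * k) = c (N * k + 1) := by rw [per1 k, ← hc.up]
  have a4 (k : ℤ) : e 1 * c (N * k + 2) = c (N * k + 1) := by
    rw [per1 k, show N * k + 2 = N * k + 1 + 1 by ring, ← hc.down]
  have a5 (k : ℤ) : e (N - 1) * c (N * k) = c (N * k - 1) := by
    have h := hc.down (N * k - 1)
    rw [sub_add_cancel] at h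
    rw [h, ← he.per_mul (N - 1) (k - 1)]
    congr 2; ring
  have a6 (k : ℤ) : e 2 * c (N * k + 1) = c (N * k + 2) := by
    rw [← he.per_mul 2 k, show N * k + 2 = N * k + 1 + 1 by ring, hc.up (N * k + 1)]
    congr 2; ring
  have prev (k : ℤ) (h : c (N * k + 2) ∈ G) : c (N * (k + 1) - 1) ∈ G := by
    rw [show N * (k + 1) - 1 = N - 1 + N * k by ring]
    rw [add_comm] at h
    exact hc.mem_of_mem_of_window he hR hG le_rfl (by omega) (by omega) le_rfl h
  have next (k : ℤ) (h : c (N * (k + 1) - 1) ∈ G) : c (N * k + 2) ∈ G := by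
    rw [show N * (k + 1) - 1 = N - 1 + N * k by ring] at h
    rw [add_comm]
    exact hc.mem_of_mem_of_window he hR hG (by omega) le_rfl le_rfl (by omega) h
  rcases eq_or_lt_of_le hN with rfl | hN4
  · have b1 (k : ℤ) : (s • e 0 - 1) * e 1 * (t • e 0 - 1) * c (3 * k + 2) =
        t • (s • c (3 * (k + 1)) - c (3 * (k + 1) + 1)) - (s • c (3 * k) - c (3 * k + 1)) := by
      have d1 := a1 (k + 1)
      rw [show 3 * (k + 1) - 1 = 3 * k + 2 by ring] at d1
      have d3 : e 1 * (e 0 * c (3 * k + 2)) = c (3 * (k + 1) + 1) := by rw [d1, a3]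
      simp only [sub_mul, mul_sub, smul_mul_assoc, mul_smul_comm, one_mul, mul_one, mul_assoc,
        d3, a4, a2]
    have b2 (k : ℤ) : e 2 * (s • c (3 * k) - c (3 * k + 1)) =
        s • c (3 * k - 1) - c (3 * k + 2) := by
      have h := a5 k
      norm_num at h
      rw [mul_sub, mul_smul_comm, h, a6]
    have hts : t * s = 1 := by rw [mul_comm, hst]
    induction k using Int.induction_on with
    | zero => simpa using ⟨h0, h1⟩
    | succ k ih =>
      have c1 := hG _ (hR 2 le_rfl (by norm_num)) _ ih.2
      rw [b2] at c1
      have c2 : c (3 * k + 2) ∈ G := (G.sub_mem_iff_right (G.smul_mem s ih.1)).1 c1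
      refine ⟨prev _ c2, ?_⟩
      have c3 := hG _ hh _ c2
      rw [b1, G.sub_mem_iff_left ih.2] at c3
      have c4 := G.smul_mem s c3
      rwa [smul_smul, hst, one_smul] at c4
    | pred k ih =>
      set l : ℤ := -(k : ℤ) - 1 with hl
      rw [show -(k : ℤ) = l + 1 by rw [hl]; ring] at ih
      have c2 := next _ ih.1
      have c3 := hG _ hh _ c2
      rw [b1, G.sub_mem_iff_right (G.smul_mem t ih.2)] at c3
      refine ⟨?_, c3⟩
      have c1 := hG _ (hR 2 le_rfl (by norm_num)) _ c3
      rw [b2, G.sub_mem_iff_left c2] at c1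
      have c4 := G.smul_mem t c1
      rwa [smul_smul, hts, one_smul] at c4
  · have fwd (k : ℤ) (h : c (N * k - 1) ∈ G) : s • c (N * k) - c (N * k + 1) ∈ G := by
      have d1 : e 1 * c (N * k - 1) ∈ Λ := by
        rw [per1 k]; exact hΛc _ _ (by omega) (by omega)
      have d2 : (s • e 0 - 1) * e 1 * (t • e 0 - 1) * c (N * k - 1) =
          t • (s • c (N * k) - c (N * k + 1)) -
            (s • (e 0 * (e 1 * c (N * k - 1))) - e 1 * c (N * k - 1)) := by
        simp only [sub_mul, mul_sub, smul_mul_assoc, mul_smul_comm, one_mul, mul_one, mul_assoc,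
          a1, a3, a2]
      have d3 := hG _ hh _ h
      rw [d2, G.sub_mem_iff_left] at d3
      · have d4 := G.smul_mem s d3
        rwa [smul_smul, hst, one_smul] at d4
      · exact hΛ (sub_mem (Λ.smul_mem s (hΛe _ _ d1)) d1)
    have bwd (k : ℤ) (h : c (N * k + 2) ∈ G) : s • c (N * k) - c (N * k + 1) ∈ G := by
      have d1 : e 0 * c (N * k + 2) ∈ Λ := by
        rw [per0 (k + 1)]; exact hΛc _ _ (by linarith) (by linarith)
      have d2 : (s • e 0 - 1) * e 1 * (t • e 0 - 1) * c (N * k + 2) =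
          (s • (e 0 * (t • (e 1 * (e 0 * c (N * k + 2))))) -
            t • (e 1 * (e 0 * c (N * k + 2)))) - (s • c (N * k) - c (N * k + 1)) := by
        simp only [sub_mul, mul_sub, smul_mul_assoc, mul_smul_comm, one_mul, mul_one, mul_assoc,
          a4, a2]
        module
      have d3 := hG _ hh _ h
      have d4 := Λ.smul_mem t (hΛe 1 _ d1)
      rwa [d2, G.sub_mem_iff_right] at d3
      exact hΛ (sub_mem (Λ.smul_mem s (hΛe _ _ d4)) d4)
    induction k using Int.induction_on with
    | zero => simpa using ⟨h0, h1⟩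
    | succ k ih =>
      have c1 := hG _ (hR 2 le_rfl (by omega)) _ ih.2
      rw [mul_sub, mul_smul_comm, a6, G.sub_mem_iff_right] at c1
      · exact ⟨prev _ c1, fwd _ (prev _ c1)⟩
      · refine G.smul_mem _ (hΛ ?_)
        rw [← he.per_mul 2 k]
        exact hΛc _ _ (by omega) (by omega)
    | pred k ih =>
      set l : ℤ := -(k : ℤ) - 1 with hl
      rw [show -(k : ℤ) = l + 1 by rw [hl]; ring] at ih
      have c0 := bwd _ (next _ ih.1)
      refine ⟨?_, c0⟩
      have c1 := hG _ (hR (N - 1) (by omega) le_rfl) _ c0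
      rw [mul_sub, mul_smul_comm, a5, G.sub_mem_iff_left] at c1
      · have c4 := G.smul_mem t c1
        rwa [smul_smul, mul_comm, hst, one_smul] at c4
      · refine hΛ ?_
        rw [← he.per_mul (N - 1) l]
        exact hΛc _ _ (by linarith) (by linarith)

lemma IsSpiral.trace_eq_zero (hst : s * t = 1) (he : IsCyclicTL N δ e) (hδ : IsUnit δ)
    (hc : IsSpiral e c) (hce : c 0 = e 0) (hN : 3 ≤ N)
    (hR : ∀ j, 2 ≤ j → j ≤ N - 1 → e j ∈ R)
    (hh : (s • e 0 - 1) * e 1 * (t • e 0 - 1) ∈ R) (hG : ∀ r ∈ R, ∀ x ∈ G, r * x ∈ G)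
    (hΛ : Λ ≤ G) (hΛe : ∀ j, ∀ x ∈ Λ, e j * x ∈ Λ)
    (hΛc : ∀ i j, i + 2 ≤ j → j ≤ i + N - 2 → e j * c i ∈ Λ)
    (h0 : c (-1) ∈ G) (h1 : s • c 0 - c 1 ∈ G) (D : A →ₗ[𝕜] 𝕜)
    (hD : ∀ x y, D (x * y) = D (y * x)) (hDG : ∀ x ∈ G, D x = 0) (i : ℤ) : D (c i) = 0 := by
  have hmem := hc.mem_and_sub_mem hst he hN hR hh hG hΛ hΛe hΛc h0 h1
  have hunit (i : ℤ) (h : D (e 0 * c i) = 0) : D (c i) = 0 := by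
    rwa [← hD, hc.right_smul he hce, map_smul, smul_eq_mul, hδ.mul_right_eq_zero] at h
  have hz (k : ℤ) : D (c (N * k)) = 0 := by
    have h := hc.up (N * k - 1)
    rw [sub_add_cancel, ← zero_add (N * k), he.per_mul, zero_add] at h
    rw [h, ← hD, hc.right_smul he hce, map_smul, hDG _ (hmem k).1, smul_zero]
  have h2 := Int.emod_nonneg i (show N ≠ 0 by omega)
  have h3 := Int.emod_lt_of_pos i (show 0 < N by omega)
  have h4 := Int.emod_add_mul_ediv i N
  set k := i / N
  set r := i % N
  obtain h | h | h : r = 0 ∨ r = 1 ∨ 2 ≤ r := by omega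
  · rw [← h4, h, zero_add, hz]
  · apply hunit
    have h5 := hc.down (N * k)
    rw [← zero_add (N * k), he.per_mul, zero_add] at h5
    rw [← h4, h, add_comm, ← h5, hz]
  · rw [← h4]
    refine hDG _ (hc.mem_of_mem_of_window he hR hG (i := N - 1) (by omega) le_rfl h (by omega) ?_)
    have h5 := (hmem (k + 1)).1
    rwa [show N * (k + 1) - 1 = N - 1 + N * k by ring] at h5

lemma IsCyclicTL.trace_eq_zero_of_ideal (hst : s * t = 1) (he : IsCyclicTL N δ e)
    (hδ : IsUnit δ) (hc : IsSpiral e c) (hce : c 0 = e 0) (hN : 3 ≤ N)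
    (hR : ∀ j, 2 ≤ j → j ≤ N - 1 → e j ∈ R)
    (hh : (s • e 0 - 1) * e 1 * (t • e 0 - 1) ∈ R) (hG : ∀ r ∈ R, ∀ x ∈ G, r * x ∈ G)
    (hΛ : Λ ≤ G) (hΛe : ∀ j, ∀ x ∈ Λ, e j * x ∈ Λ)
    (hΛc : ∀ i j, i + 2 ≤ j → j ≤ i + N - 2 → e j * c i ∈ Λ)
    (h0 : c (-1) ∈ G) (h1 : s • c 0 - c 1 ∈ G) (D : A →ₗ[𝕜] 𝕜)
    (hD : ∀ x y, D (x * y) = D (y * x)) (hDG : ∀ x ∈ G, D x = 0) (hD1 : D 1 = 0)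
    (hgen : Algebra.adjoin 𝕜 (Set.range e) = ⊤) : D = 0 := by
  have hDc := hc.trace_eq_zero hst he hδ hce hN hR hh hG hΛ hΛe hΛc h0 h1 D hD hDG
  set Q := Λ ⊔ Submodule.span 𝕜 (Set.range c)
  have hcQ (i : ℤ) : c i ∈ Q := Submodule.mem_sup_right (Submodule.subset_span ⟨i, rfl⟩)
  have hΛQ {x : A} (hx : x ∈ Λ) : x ∈ Q := Submodule.mem_sup_left hx
  have hec (i j : ℤ) : e j * c i ∈ Q := by
    rcases hc.left_mul he (by omega) i j with ⟨r, i', h⟩ | ⟨j', h1, h2, h⟩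
    · rw [h]; exact Q.smul_mem _ (hcQ _)
    · rw [h]; exact hΛQ (hΛc _ _ h1 h2)
  have heQ (j : ℤ) : ∀ x ∈ Q, e j * x ∈ Q := by
    intro x hx
    have h : Q ≤ Q.comap (LinearMap.mulLeft 𝕜 (e j)) := by
      refine sup_le (fun y hy => hΛQ (hΛe j y hy)) (Submodule.span_le.2 ?_)
      rintro _ ⟨i, rfl⟩
      exact hec i j
    exact h hx
  have hDQ : ∀ x ∈ Q, D x = 0 := by
    have : Q ≤ LinearMap.ker D := by
      refine sup_le (fun x hx => hDG x (hΛ hx)) (Submodule.span_le.2 ?_)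
      rintro _ ⟨i, rfl⟩
      exact hDc i
    exact fun x hx => this hx
  have hAQ (a : A) : ∀ x ∈ Q, a * x ∈ Q := by
    have ha : a ∈ Algebra.adjoin 𝕜 (Set.range e) := hgen ▸ Algebra.mem_top
    induction ha using Algebra.adjoin_induction with
    | mem a ha => obtain ⟨j, rfl⟩ := ha; exact heQ j
    | algebraMap r => intro x hx; rw [← Algebra.smul_def]; exact Q.smul_mem _ hx
    | add a b _ _ ha hb => intro x hx; rw [add_mul]; exact add_mem (ha x hx) (hb x hx)
    | mul a b _ _ ha hb => intro x hx; rw [mul_assoc]; exact ha _ (hb x hx)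
  have hDe (a : A) (j : ℤ) : D (a * e j) = 0 := by
    induction j using Int.induction_on generalizing a with
    | zero => exact hDQ _ (hAQ a _ (hce ▸ hcQ 0))
    | succ j ih => rw [← he.down, ← mul_assoc, hD, ← mul_assoc, ← mul_assoc]; exact ih _
    | pred j ih =>
      have h := he.up (-j - 1)
      rw [sub_add_cancel] at h
      rw [← h, ← mul_assoc, hD, ← mul_assoc, ← mul_assoc]
      exact ih _
  have key (a : A) : ∃ r : 𝕜, ∀ b, D (b * (a - algebraMap 𝕜 A r)) = 0 := by
    have ha : a ∈ Algebra.adjoin 𝕜 (Set.range e) := hgen ▸ Algebra.mem_top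
    induction ha using Algebra.adjoin_induction with
    | mem a ha => obtain ⟨j, rfl⟩ := ha; exact ⟨0, fun b => by simpa using hDe b j⟩
    | algebraMap r => exact ⟨r, by simp⟩
    | add a a' _ _ ha ha' =>
      obtain ⟨r, hr⟩ := ha
      obtain ⟨r', hr'⟩ := ha'
      refine ⟨r + r', fun b => ?_⟩
      rw [map_add, add_sub_add_comm, mul_add, map_add, hr, hr', add_zero]
    | mul a a' _ _ ha ha' =>
      obtain ⟨r, hr⟩ := ha
      obtain ⟨r', hr'⟩ := ha'
      refine ⟨r * r', fun b => ?_⟩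
      have h : b * (a * a' - algebraMap 𝕜 A (r * r')) =
          b * a * (a' - algebraMap 𝕜 A r') + r' • (b * (a - algebraMap 𝕜 A r)) := by
        simp only [Algebra.algebraMap_eq_smul_one, mul_sub, mul_smul_comm, mul_one, smul_sub,
          smul_smul, mul_assoc, mul_comm r]
        abel
      rw [h, map_add, map_smul, hr, hr', smul_zero, add_zero]
  ext a
  obtain ⟨r, hr⟩ := key a
  have h := hr 1
  rwa [one_mul, map_sub, Algebra.algebraMap_eq_smul_one, map_smul, hD1, smul_zero, sub_zero] at h

end

/-- The double conjugate of `z` is the transverse element to `b`. -/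
lemma conj_conj_mul {a b z : A} (hst : s * t = 1) (haa : a * a = (s + t) • a)
    (hbb : b * b = (s + t) • b) (haba : a * b * a = a) (hbab : b * a * b = b)
    (haz : a * z = z * a) :
    b * ((s • a - 1) * ((s • b - 1) * z * (t • b - 1)) * (t • a - 1)) = b * a * z * b ∧
      (s • a - 1) * ((s • b - 1) * z * (t • b - 1)) * (t • a - 1) * b = b * a * z * b := by
  have h1 : b * (s • a - 1) * (s • b - 1) = -(s • (b * a)) := by
    simp only [mul_sub, sub_mul, mul_smul_comm, smul_mul_assoc, hbab, hbb, mul_one]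
    match_scalars <;> first | ring1 | linear_combination -hst
  have h2 : (t • b - 1) * (t • a - 1) * b = -(t • (a * b)) := by
    simp only [mul_sub, sub_mul, mul_smul_comm, smul_mul_assoc, hbab, hbb, mul_one, one_mul]
    match_scalars <;> first | ring1 | linear_combination -hst
  have h3 : b * a * z * ((t • b - 1) * (t • a - 1)) = -(t • (b * a * z * b)) := by
    have e1 : b * a * z * b * a = b * a * z := by
      rw [mul_assoc b, haz]
      simp only [mul_assoc]
      rw [← mul_assoc a b, haba]
    have e2 : b * a * z * a = (s + t) • (b * a * z) := by
      rw [mul_assoc, ← haz, ← mul_assoc, mul_assoc b, haa, mul_smul_comm, smul_mul_assoc]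
    simp only [mul_sub, sub_mul, mul_smul_comm, smul_mul_assoc, ← mul_assoc, e1, e2, mul_one]
    match_scalars <;> first | ring1 | linear_combination -hst
  have h4 : (s • a - 1) * (s • b - 1) * (z * a * b) = -(s • (b * a * z * b)) := by
    have e1 : a * (b * (z * (a * b))) = z * (a * b) := by
      rw [← mul_assoc z, ← haz, mul_assoc a, ← mul_assoc b, ← mul_assoc a, ← mul_assoc a, haba,
        ← mul_assoc, haz, mul_assoc]
    have e2 : a * (z * (a * b)) = (s + t) • (z * (a * b)) := by
      rw [← mul_assoc, haz, mul_assoc, ← mul_assoc a, haa, smul_mul_assoc, mul_smul_comm]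
    have e3 : b * (a * (z * b)) = b * (z * (a * b)) := by rw [← mul_assoc a, haz, mul_assoc]
    simp only [mul_sub, sub_mul, mul_smul_comm, smul_mul_assoc, mul_assoc, e1, e2, e3, mul_one,
      one_mul]
    match_scalars <;> first | ring1 | linear_combination -hst
  constructor
  · calc _ = b * (s • a - 1) * (s • b - 1) * z * ((t • b - 1) * (t • a - 1)) := by
          simp only [mul_assoc]
      _ = _ := by
        rw [h1, neg_mul, smul_mul_assoc, neg_mul, smul_mul_assoc, h3, smul_neg, neg_neg,
          smul_smul, hst, one_smul]
  · calc _ = (s • a - 1) * (s • b - 1) * z * ((t • b - 1) * (t • a - 1) * b) := by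
          simp only [mul_assoc]
      _ = _ := by
        rw [h2, mul_neg, mul_smul_comm, ← mul_assoc, mul_assoc _ z, mul_assoc _ (z * a), h4, smul_neg,
          neg_neg, smul_smul, mul_comm, hst, one_smul]

/-- A transverse family centralizing `e 0` and lying in the subalgebra `R`. -/
lemma IsCyclicTL.exists_isTransverse {R : Subalgebra 𝕜 A} (hst : s * t = 1)
    (he : IsCyclicTL N (s + t) e) (hc : IsSpiral e c) (hce : c 0 = e 0) (hN : 4 ≤ N)
    (hR : ∀ j, 2 ≤ j → j ≤ N - 1 → e j ∈ R)
    (hh : (s • e 0 - 1) * e 1 * (t • e 0 - 1) ∈ R) :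
    ∃ ε, IsTransverse N e c ε ∧ ∀ j, ε j ∈ R ∧ ε j * e 0 = e 0 * ε j := by
  have hpos : 0 < N - 2 := by omega
  have hlast : e (N - 1) = e (-1) := by rw [← he.per (-1)]; congr 1; ring
  have haR : e (-1) ∈ R := hlast ▸ hR _ (by omega) le_rfl
  have hbab := he.down (-1)
  have haba := he.up (-1)
  have hzbz := he.down 0
  have haz := he.comm (-1) 1 (by omega) (by omega)
  norm_num at hbab haba hzbz
  obtain ⟨h1, h2⟩ := conj_conj_mul hst (he.sq _) (he.sq _) haba hbab haz
  set κ := (s • e (-1) - 1) * ((s • e 0 - 1) * e 1 * (t • e 0 - 1)) * (t • e (-1) - 1)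
  have hκR : κ ∈ R :=
    mul_mem (mul_mem (sub_mem (R.smul_mem haR s) (one_mem R)) hh)
      (sub_mem (R.smul_mem haR t) (one_mem R))
  set ε : ℤ → A := fun j =>
    if (j - 2) % (N - 2) + 2 ≤ N - 2 then e ((j - 2) % (N - 2) + 2) else κ with hε
  have hεj (j : ℤ) (h3 : 2 ≤ j) (h4 : j ≤ N - 1) : ε j = if j ≤ N - 2 then e j else κ := by
    simp only [hε, Int.emod_eq_of_lt (show 0 ≤ j - 2 by omega) (show j - 2 < N - 2 by omega),
      sub_add_cancel]
  refine ⟨ε, .of_base he hc hN (fun j => ?_) (fun j h3 h4 => ?_), fun j => ?_⟩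
  · simp only [hε, add_sub_right_comm j, Int.add_emod_right]
  · rw [hεj j h3 h4]
    split_ifs with h5
    · exact ⟨0, by omega, by omega, by rw [hce, he.comm 0 j (by omega) (by omega)]⟩
    · obtain rfl : j = N - 1 := by omega
      have h6 := hc.up 0
      rw [zero_add] at h6
      refine ⟨1, by omega, by omega, ?_⟩
      rw [hlast, h6, hce, mul_assoc (e 1) (e 0), h1, mul_assoc (e 0) (e (-1)), haz]
      simp only [← mul_assoc]
      rw [haz, hzbz]
  · simp only [hε]
    have h3 := Int.emod_nonneg (j - 2) hpos.ne'
    split_ifs with h5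
    · exact ⟨hR _ (by omega) (by omega), (he.comm _ _ (by omega) (by omega)).symm⟩
    · exact ⟨hκR, by rw [h1, h2]⟩

theorem IsCyclicTL.trace_eq_zero {R : Subalgebra 𝕜 A} (hst : s * t = 1)
    (he : IsCyclicTL N (s + t) e) (hδ : IsUnit (s + t)) (hN : 3 ≤ N)
    (hR : ∀ j, 2 ≤ j → j ≤ N - 1 → e j ∈ R)
    (hh : (s • e 0 - 1) * e 1 * (t • e 0 - 1) ∈ R)
    (hgen : Algebra.adjoin 𝕜 (Set.range e) = ⊤) (D : A →ₗ[𝕜] 𝕜)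
    (hD : ∀ x y, D (x * y) = D (y * x)) (hDR : ∀ r ∈ R, D r = 0)
    (hDe : ∀ r ∈ R, D (r * e 0) = 0) : D = 0 := by
  have hc := he.isSpiral_spiral
  have hce := spiral_zero e
  generalize spiral e = c at hc hce
  set G : Submodule 𝕜 A := (Subalgebra.toSubmodule R).map (LinearMap.mulRight 𝕜 (e 0))
  have hmem {r : A} (hr : r ∈ R) : r * e 0 ∈ G := ⟨r, hr, rfl⟩
  have hG : ∀ r ∈ R, ∀ x ∈ G, r * x ∈ G := by
    rintro r hr _ ⟨x, hx, rfl⟩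
    rw [LinearMap.mulRight_apply, ← mul_assoc]
    exact hmem (mul_mem hr hx)
  have hDG : ∀ x ∈ G, D x = 0 := by
    rintro _ ⟨r, hr, rfl⟩
    exact hDe r hr
  have hlast : e (N - 1) = e (-1) := by rw [← he.per (-1)]; congr 1; ring
  have hcneg := hc.down (-1)
  have hcone := hc.up 0
  rw [neg_add_cancel, hce] at hcneg
  rw [zero_add, hce] at hcone
  have h0 : c (-1) ∈ G := by
    rw [hcneg, ← hlast]
    exact hmem (hR _ (by omega) le_rfl)
  have h1 : s • c 0 - c 1 ∈ G := by
    have h2 := G.smul_mem (s * s) (hmem hh)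
    have h3 : (s * s) • ((s • e 0 - 1) * e 1 * (t • e 0 - 1) * e 0) = s • c 0 - c 1 := by
      have h4 := he.up 0
      rw [zero_add] at h4
      rw [hce, hcone]
      simp only [mul_sub, sub_mul, mul_smul_comm, smul_mul_assoc, h4, one_mul,
        mul_one, he.sq, mul_assoc _ (e 0) (e 0)]
      match_scalars
      · linear_combination (s ^ 3 + s * (s * t + 1)) * hst
      · linear_combination -(s ^ 2 + s * t + 1) * hst
    rwa [h3] at h2
  suffices h : ∃ Λ : Submodule 𝕜 A, Λ ≤ G ∧ (∀ j, ∀ x ∈ Λ, e j * x ∈ Λ) ∧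
      ∀ i j, i + 2 ≤ j → j ≤ i + N - 2 → e j * c i ∈ Λ by
    obtain ⟨Λ, hΛ, hΛe, hΛc⟩ := h
    exact he.trace_eq_zero_of_ideal hst hδ hc hce hN hR hh hG hΛ hΛe hΛc h0 h1 D hD hDG
      (hDR 1 (one_mem R)) hgen
  rcases eq_or_lt_of_le hN with rfl | hN4
  · exact ⟨⊥, bot_le, by simp, fun i j h2 h3 => by omega⟩
  obtain ⟨ε, hε, hεC⟩ := he.exists_isTransverse hst hc hce hN4 hR hh
  set C : Subalgebra 𝕜 A := R ⊓ Subalgebra.centralizer 𝕜 {e 0}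
  have hC (j : ℤ) : ε j ∈ C :=
    ⟨(hεC j).1, Subalgebra.mem_centralizer_iff 𝕜 |>.2 (by simpa using (hεC j).2.symm)⟩
  have hGC : ∀ y ∈ G, ∀ x ∈ C, y * x ∈ G := by
    rintro _ ⟨r, hr, rfl⟩ x ⟨hx, hx'⟩
    rw [LinearMap.mulRight_apply, mul_assoc,
      Subalgebra.mem_centralizer_iff 𝕜 |>.1 hx' (e 0) rfl, ← mul_assoc]
    exact hmem (mul_mem hr hx)
  have hcG (i : ℤ) (h2 : 2 - N ≤ i) (h3 : i < 2 - N + N) : c i ∈ G := by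
    obtain h | rfl | rfl : i ≤ -1 ∨ i = 0 ∨ i = 1 := by omega
    · have h4 := hc.mem_of_mem_of_window he hR hG (k := -1) (i := N - 1) (j := i + N)
        (by omega) le_rfl (by omega) (by omega) (by simpa [show N - 1 + -N = -1 by ring] using h0)
      simpa using h4
    · rw [hce, ← one_mul (e 0)]; exact hmem (one_mem R)
    · exact (G.sub_mem_iff_right (G.smul_mem s (hce ▸ one_mul (e 0) ▸ hmem (one_mem R)))).1 h1
  have hεG := hε.mem_of_window he hc hN4 hC (G := G) hGC (2 - N)
    fun i h2 h3 k => hGC _ (hcG i h2 h3) _ (hC k)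
  set S : Set A := {y | ∃ i k, ∃ x ∈ C, y = c i * ε k * x}
  refine ⟨Submodule.span 𝕜 S, Submodule.span_le.2 ?_, fun j => ?_, fun i j h2 h3 => ?_⟩
  · rintro _ ⟨i, k, x, hx, rfl⟩
    exact hGC _ (hεG i k) _ hx
  · suffices h : Submodule.span 𝕜 S ≤ (Submodule.span 𝕜 S).comap (LinearMap.mulLeft 𝕜 (e j)) from
      fun x hx => h hx
    refine Submodule.span_le.2 ?_
    rintro _ ⟨i, k, x, hx, rfl⟩
    change e j * (c i * ε k * x) ∈ Submodule.span 𝕜 S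
    rw [← mul_assoc, ← mul_assoc]
    rcases hc.left_mul he (by omega) i j with ⟨r, i', h⟩ | ⟨j', h2, h3, h⟩
    · rw [h, smul_mul_assoc, smul_mul_assoc]
      exact Submodule.smul_mem _ _ (Submodule.subset_span ⟨i', k, x, hx, rfl⟩)
    · rw [h, hε.act i j' h2 h3, mul_assoc]
      exact Submodule.subset_span ⟨i, j', _, mul_mem (hC k) hx, rfl⟩
  · rw [hε.act i j h2 h3]
    exact Submodule.subset_span ⟨i, j, 1, one_mem C, (mul_one _).symm⟩

end

section

variable {𝕜 A : Type*} [CommRing 𝕜] [Ring A] [Algebra 𝕜 A] {q : 𝕜} {x y : A}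

lemma add_one_mul_self_of_quad (h : x * x = (q - 1) • x + algebraMap 𝕜 A q) :
    (x + 1) * (x + 1) = (q + 1) • (x + 1) := by
  rw [add_mul, mul_add, mul_one, one_mul, h, Algebra.algebraMap_eq_smul_one]
  module

lemma add_one_mul_mul_of_vel (h : x * x = (q - 1) • x + algebraMap 𝕜 A q) (hv : Vel x y = 0) :
    (x + 1) * (y + 1) * (x + 1) = q • (x + 1) := by
  have h1 : (x + 1) * (y + 1) * (x + 1) = Vel x y + (x * x + x) := by
    rw [Vel]; noncomm_ring
  rw [h1, hv, h, Algebra.algebraMap_eq_smul_one]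
  module

lemma vel_comm_of_braid (h : x * y * x = y * x * y) : Vel x y = Vel y x := by
  rw [Vel, Vel, h]; abel

end

section

variable {𝕜 : Type*} [CommRing 𝕜] {q : 𝕜} {n : ℕ}

lemma gg_quad (i : Fin (n + 1)) :
    gg 𝕜 q n i * gg 𝕜 q n i = (q - 1) • gg 𝕜 q n i + algebraMap 𝕜 _ q := by
  simpa [gg] using RingQuot.mkAlgHom_rel 𝕜 (ATLRel.quad (K := 𝕜) (q := q) i)

lemma gg_mul_ggInv [Invertible q] (i : Fin (n + 1)) : gg 𝕜 q n i * ggInv 𝕜 q n i = 1 := by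
  rw [ggInv, mul_smul_comm, mul_sub, gg_quad, Algebra.algebraMap_eq_smul_one,
    Algebra.algebraMap_eq_smul_one, mul_smul_comm, mul_one, add_sub_cancel_left, smul_smul,
    invOf_mul_self, one_smul]

lemma gg_commute_of_lt (hn : 2 ≤ n) {i j : Fin (n + 1)} (hij : (i : ℕ) + 2 ≤ j)
    (h : (j : ℕ) < i + n) : gg 𝕜 q n i * gg 𝕜 q n j = gg 𝕜 q n j * gg 𝕜 q n i := by
  rcases eq_or_ne j (Fin.last n) with rfl | hj
  · rw [Fin.val_last] at hij h
    simpa [gg] using RingQuot.mkAlgHom_rel 𝕜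
      (ATLRel.comm_sa (K := 𝕜) (q := q) hn i (by omega) (by omega))
  · have hj' := Fin.val_lt_last hj
    simpa [gg] using RingQuot.mkAlgHom_rel 𝕜
      (ATLRel.comm_ss (K := 𝕜) (q := q) i j (by omega) hj'
        (by rw [Nat.dist_eq_sub_of_le] <;> omega))

lemma gg_braid_and_vel (hn : 2 ≤ n) {i j : Fin (n + 1)}
    (h : (j : ℕ) = i + 1 ∨ (i : ℕ) = n ∧ (j : ℕ) = 0) :
    gg 𝕜 q n i * gg 𝕜 q n j * gg 𝕜 q n i = gg 𝕜 q n j * gg 𝕜 q n i * gg 𝕜 q n j ∧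
      Vel (gg 𝕜 q n i) (gg 𝕜 q n j) = 0 := by
  rcases h with h | ⟨h1, h2⟩
  · rcases eq_or_ne j (Fin.last n) with rfl | hj
    · rw [Fin.val_last] at h
      constructor
      · simpa [gg] using RingQuot.mkAlgHom_rel 𝕜
          (ATLRel.braid_sa (K := 𝕜) (q := q) hn i (.inr h.symm))
      · simpa [gg, Vel] using RingQuot.mkAlgHom_rel 𝕜
          (ATLRel.v_sna (K := 𝕜) (q := q) hn i h.symm)
    · have hj' := Fin.val_lt_last hj
      constructor
      · simpa [gg] using RingQuot.mkAlgHom_rel 𝕜 (ATLRel.braid_ss (K := 𝕜) (q := q) i j hj' h)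
      · simpa [gg, Vel] using RingQuot.mkAlgHom_rel 𝕜
          (ATLRel.v_ss (K := 𝕜) (q := q) i j hj' h)
  · obtain rfl : i = Fin.last n := Fin.ext h1
    have hb : gg 𝕜 q n j * gg 𝕜 q n (Fin.last n) * gg 𝕜 q n j =
        gg 𝕜 q n (Fin.last n) * gg 𝕜 q n j * gg 𝕜 q n (Fin.last n) := by
      simpa [gg] using RingQuot.mkAlgHom_rel 𝕜
        (ATLRel.braid_sa (K := 𝕜) (q := q) hn j (.inl h2))
    refine ⟨hb.symm, ?_⟩
    rw [← vel_comm_of_braid hb]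
    simpa [gg, Vel] using RingQuot.mkAlgHom_rel 𝕜 (ATLRel.v_s1a (K := 𝕜) (q := q) hn j h2)

lemma adjoin_range_gg : Algebra.adjoin 𝕜 (Set.range (gg 𝕜 q n)) = ⊤ := by
  refine eq_top_iff.2 fun a _ => ?_
  obtain ⟨b, rfl⟩ := RingQuot.mkAlgHom_surjective 𝕜 (ATLRel 𝕜 q n) a
  induction b using FreeAlgebra.induction with
  | grade0 r => rw [AlgHom.commutes]; exact Subalgebra.algebraMap_mem _ r
  | grade1 i => exact Algebra.subset_adjoin ⟨i, rfl⟩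
  | mul a b ha hb => rw [map_mul]; exact mul_mem (ha trivial) (hb trivial)
  | add a b ha hb => rw [map_add]; exact add_mem (ha trivial) (hb trivial)

/-- The integers modulo `n + 1` as indices of the generators of `TL̂_{n+1}(q)`, with `0` standing
for `g_{σ_n}` and `1` for `g_{a_{n+1}}`. -/
def cyclicIndex (n : ℕ) (i : ℤ) : Fin (n + 1) :=
  ⟨((i + n - 1) % (n + 1)).toNat, by
    have h1 := Int.emod_nonneg (i + n - 1) (show (n + 1 : ℤ) ≠ 0 by omega)
    have h2 := Int.emod_lt_of_pos (i + n - 1) (show 0 < (n + 1 : ℤ) by omega)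
    omega⟩

lemma coe_cyclicIndex (n : ℕ) (i : ℤ) :
    ((cyclicIndex n i : ℕ) : ℤ) = (i + n - 1) % (n + 1) :=
  Int.toNat_of_nonneg (Int.emod_nonneg _ (by omega))

lemma cyclicIndex_eq {i : ℤ} {k : Fin (n + 1)} (h : i + n - 1 = k) : cyclicIndex n i = k := by
  have h1 := coe_cyclicIndex n i
  rw [h, Int.emod_eq_of_lt (by omega) (by omega)] at h1
  exact Fin.ext (by exact_mod_cast h1)

/-- The Temperley–Lieb generators `t • (g + 1)` of `TL̂_{n+1}(q)`. -/
noncomputable def cyclicGen (q : 𝕜) (n : ℕ) (t : 𝕜) (i : ℤ) : TLhat 𝕜 q n :=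
  t • (gg 𝕜 q n (cyclicIndex n i) + 1)

lemma isCyclicTL_cyclicGen {s t : 𝕜} (hs : s * s = q) (hst : s * t = 1) (hn : 2 ≤ n) :
    IsCyclicTL (n + 1) (s + t) (cyclicGen q n t) := by
  have hadj (i : ℤ) : (cyclicIndex n (i + 1) : ℕ) = cyclicIndex n i + 1 ∨
      (cyclicIndex n i : ℕ) = n ∧ (cyclicIndex n (i + 1) : ℕ) = 0 := by
    have h1 := coe_cyclicIndex n i
    have h2 := coe_cyclicIndex n (i + 1)
    rw [show i + 1 + n - 1 = i + n - 1 + 1 by ring, ← Int.emod_add_emod, ← h1] at h2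
    have h3 := (cyclicIndex n i).is_lt
    rcases eq_or_ne (cyclicIndex n i : ℕ) n with h4 | h4
    · rw [h4, Int.emod_self] at h2
      exact .inr ⟨h4, by exact_mod_cast h2⟩
    · rw [Int.emod_eq_of_lt (by omega) (by omega)] at h2
      exact .inl (by exact_mod_cast h2)
  have htq : t * t * q = 1 := by linear_combination (s * t + 1) * hst - t * t * hs
  have hcube {x y : TLhat 𝕜 q n} (hx : x * x = (q - 1) • x + algebraMap 𝕜 _ q)
      (hv : Vel x y = 0) : t • (x + 1) * t • (y + 1) * t • (x + 1) = t • (x + 1) := by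
    simp only [smul_mul_assoc, mul_smul_comm, add_one_mul_mul_of_vel hx hv, smul_smul]
    congr 1
    linear_combination t * htq
  constructor
  · intro i
    rw [cyclicGen, smul_mul_smul_comm, add_one_mul_self_of_quad (gg_quad _), smul_smul, smul_smul]
    congr 1
    linear_combination htq - hst
  · intro i
    have h : cyclicIndex n (i + (n + 1)) = cyclicIndex n i := Fin.ext <| by
      zify
      rw [coe_cyclicIndex, coe_cyclicIndex,
        show i + (n + 1 : ℤ) + n - 1 = i + n - 1 + (n + 1) by ring, Int.add_emod_right]
    rw [cyclicGen, h, cyclicGen]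
  · intro i
    exact hcube (gg_quad _) (gg_braid_and_vel hn (hadj i)).2
  · intro i
    have h := gg_braid_and_vel (𝕜 := 𝕜) (q := q) hn (hadj i)
    exact hcube (gg_quad _) (vel_comm_of_braid h.1 ▸ h.2)
  · intro i j h1 h2
    have hcomm : gg 𝕜 q n (cyclicIndex n i) * gg 𝕜 q n (cyclicIndex n j) =
        gg 𝕜 q n (cyclicIndex n j) * gg 𝕜 q n (cyclicIndex n i) := by
      have h3 := coe_cyclicIndex n i
      have h4 := coe_cyclicIndex n j
      have h5 := (cyclicIndex n i).is_lt
      have h6 := (cyclicIndex n j).is_lt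
      rw [show j + n - 1 = i + n - 1 + (j - i) by ring, ← Int.emod_add_emod, ← h3] at h4
      rcases lt_or_ge ((cyclicIndex n i : ℕ) + (j - i)) (n + 1) with h7 | h7
      · rw [Int.emod_eq_of_lt (by omega) h7] at h4
        exact gg_commute_of_lt hn (by omega) (by omega)
      · rw [← Int.sub_emod_right, Int.emod_eq_of_lt (by omega) (by omega)] at h4
        exact (gg_commute_of_lt hn (by omega) (by omega)).symm
    simp only [cyclicGen, smul_mul_smul_comm, add_mul, mul_add, one_mul, mul_one, hcomm]
    congr 1
    abel

lemma adjoin_range_cyclicGen {s t : 𝕜} (hst : s * t = 1) :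
    Algebra.adjoin 𝕜 (Set.range (cyclicGen q n t)) = ⊤ := by
  rw [eq_top_iff, ← adjoin_range_gg, Algebra.adjoin_le_iff]
  rintro _ ⟨k, rfl⟩
  have h1 : cyclicGen q n t (k + 1 - n) ∈ Algebra.adjoin 𝕜 (Set.range (cyclicGen q n t)) :=
    Algebra.subset_adjoin ⟨_, rfl⟩
  have h2 := sub_mem (Subalgebra.smul_mem _ h1 s) (one_mem _)
  rwa [cyclicGen, cyclicIndex_eq (k := k) (by ring), smul_smul, hst, one_smul,
    add_sub_cancel_right] at h2

end

/-- for `n ≥ 2`, any trace on `TL̂_{n+1}(q)` is uniquely determined by its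
values on the Markov elements. -/
theorem trace_determined_by_markov_elements
    (K : Type*) [CommRing K] [IsDomain K] [CharZero K]
    (q sq : K) [Invertible q] [Invertible (q + 1)] (hsq : sq * sq = q)
    (n : ℕ) (hn : 2 ≤ n)
    (F : TLhat K q (n - 1) →ₐ[K] TLhat K q n) (hF : IsF K q n F)
    (τ τ' : TLhat K q n →ₗ[K] K) (hτ : IsTrace K τ) (hτ' : IsTrace K τ')
    (hM : ∀ M : TLhat K q n, IsMarkov K q n F M → τ M = τ' M) :
    τ = τ' := by
  have hst : sq * (sq * ⅟q) = 1 := by rw [← mul_assoc, hsq, mul_invOf_self]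
  have htt : sq * ⅟q * (sq * ⅟q) = ⅟q := by
    rw [mul_mul_mul_comm, hsq, ← mul_assoc, mul_invOf_self, one_mul]
  have h0 : cyclicIndex n 0 = sigmaTop n :=
    cyclicIndex_eq (by simp only [sigmaTop]; omega)
  have h1 : cyclicIndex n 1 = Fin.last n := cyclicIndex_eq (by simp)
  refine sub_eq_zero.1 <|
    (isCyclicTL_cyclicGen hsq hst hn).trace_eq_zero (R := F.range) hst ?_ (by omega) ?_ ?_
      (adjoin_range_cyclicGen hst) (τ - τ') ?_ ?_ ?_
  · refine .of_mul_eq_one (sq * ⅟(q + 1)) ?_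
    calc _ = (sq * sq + sq * (sq * ⅟q)) * ⅟(q + 1) := by ring
      _ = 1 := by rw [hsq, hst, mul_invOf_self]
  · intro j h2 h3
    obtain ⟨k, rfl⟩ : ∃ k : ℕ, j = k + 2 := ⟨(j - 2).toNat, by omega⟩
    have h4 := hF.1 ⟨k, by omega⟩ (by change k < n - 1; omega)
    refine F.range.smul_mem (add_mem ?_ (one_mem _)) _
    rw [show cyclicIndex n (k + 2) =
      Fin.castLE (Nat.succ_le_succ (Nat.sub_le n 1)) ⟨k, by omega⟩ from ?_]
    · exact ⟨_, h4⟩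
    · have h5 := coe_cyclicIndex n (k + 2)
      rw [show (k + 2 + n - 1 : ℤ) = k + (n + 1) by ring, Int.add_emod_right,
        Int.emod_eq_of_lt (by omega) (by omega)] at h5
      exact Fin.ext (by exact_mod_cast h5)
  · refine ⟨(sq * ⅟q) • (gg K q (n - 1) (Fin.last (n - 1)) + 1), ?_⟩
    have h2 : sq • cyclicGen q n (sq * ⅟q) 0 - 1 = gg K q n (sigmaTop n) := by
      rw [cyclicGen, smul_smul, hst, one_smul, h0, add_sub_cancel_right]
    have h3 : (sq * ⅟q) • cyclicGen q n (sq * ⅟q) 0 - 1 = ggInv K q n (sigmaTop n) := by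
      rw [cyclicGen, smul_smul, htt, h0, ggInv, Algebra.algebraMap_eq_smul_one]
      match_scalars
      · ring
      · linear_combination invOf_mul_self q
    simp only [RingHom.coe_coe, AlgHom.toRingHom_eq_coe]
    rw [h2, h3, cyclicGen, h1, map_smul, map_add, map_one, hF.2, mul_smul_comm, smul_mul_assoc,
      mul_add, mul_one, add_mul, gg_mul_ggInv]
  · intro x y
    rw [LinearMap.sub_apply, LinearMap.sub_apply, hτ, hτ']
  · rintro _ ⟨a, rfl⟩
    exact sub_eq_zero.2 (hM _ ⟨a, 1, 0, zero_le_one, by simp⟩)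
  · rintro _ ⟨a, rfl⟩
    have h2 := hM _ ⟨a, 1, 1, le_rfl, rfl⟩
    have h3 := hM (F a) ⟨a, 1, 0, zero_le_one, by simp⟩
    rw [map_one, pow_one, mul_one] at h2
    rw [cyclicGen, h0, mul_smul_comm, mul_add, mul_one, map_smul, map_add]
    simp [h2, h3]
end

section
/- Let n ≥ 2, and let τ, τ' be traces on TL̂_{n+1}(q). If τ(M) = τ'(M) for every Markov element M and τ(X^k) = τ'(X^k) for every integer k ≥ 0, then τ = τ'. -/
open FreeAlgebra

variable (K : Type*) [CommRing K] (q : K) (n : ℕ)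

namespace AffineTL

section Words

variable {K q n} {A : Type*} [Ring A] [Algebra K A]

/-- Cyclic adjacency of indices. -/
def Adj (i j : Fin (n + 1)) : Prop := j = i + 1 ∨ i = j + 1

theorem Adj.symm {i j : Fin (n + 1)} (h : Adj i j) : Adj j i := Or.symm h

theorem adj_add_one (i : Fin (n + 1)) : Adj i (i + 1) := Or.inl rfl

/-- Every index has at most one neighbour besides a given one. -/
theorem Adj.exists_other {i j : Fin (n + 1)} (h : Adj i j) :
    ∃ j', Adj i j' ∧ ∀ k, Adj i k → k = j ∨ k = j' := by
  rcases h with rfl | rfl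
  · refine ⟨i - 1, Or.inr (by simp), ?_⟩
    rintro k (rfl | rfl)
    · exact Or.inl rfl
    · right; simp
  · refine ⟨j + 1 + 1, Or.inl rfl, ?_⟩
    rintro k (rfl | h)
    · exact Or.inr rfl
    · exact Or.inl (add_right_cancel h).symm

/-- The Temperley–Lieb relations for a family indexed by a cycle, in the normalization
`e_i² = (q + 1) e_i`, `e_i e_j e_i = q e_i`. -/
structure IsTL (q : K) (e : Fin (n + 1) → A) : Prop where
  sq : ∀ i, e i * e i = (q + 1) • e i
  comm : ∀ i j, i ≠ j → ¬ Adj i j → Commute (e i) (e j)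
  adj : ∀ i j, Adj i j → e i * e j * e i = q • e i

/-- The product of the generators along a list of indices. -/
def word (e : Fin (n + 1) → A) (w : List (Fin (n + 1))) : A := (w.map e).prod

/-- The span of the words of length less than `m`. -/
def shorter (K : Type*) [CommRing K] {n : ℕ} {A : Type*} [Ring A] [Algebra K A]
    (e : Fin (n + 1) → A) (m : ℕ) : Submodule K A :=
  Submodule.span K {x | ∃ w : List (Fin (n + 1)), w.length < m ∧ word e w = x}

variable {e : Fin (n + 1) → A}

@[simp] theorem word_nil : word e [] = 1 := by simp [word]

@[simp] theorem word_cons (i : Fin (n + 1)) (w : List (Fin (n + 1))) :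
    word e (i :: w) = e i * word e w := by simp [word]

@[simp] theorem word_append (v w : List (Fin (n + 1))) :
    word e (v ++ w) = word e v * word e w := by simp [word]

theorem word_flatten_replicate (c : List (Fin (n + 1))) (k : ℕ) :
    word e (List.replicate k c).flatten = word e c ^ k := by
  induction k with
  | zero => simp
  | succ k ih => simp [List.replicate_succ, pow_succ', ih]

theorem word_mem_shorter {w : List (Fin (n + 1))} {m : ℕ} (h : w.length < m) :
    word e w ∈ shorter K e m :=
  Submodule.subset_span ⟨w, h, rfl⟩

theorem shorter_mono {l m : ℕ} (h : l ≤ m) : shorter K e l ≤ shorter K e m :=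
  Submodule.span_mono fun _ ⟨w, hw, hx⟩ => ⟨w, hw.trans_le h, hx⟩

theorem mul_mem_shorter {l m r : ℕ} {x y : A} (hx : x ∈ shorter K e l) (hy : y ∈ shorter K e m)
    (hr : l + m ≤ r + 1) : x * y ∈ shorter K e r := by
  have h := Submodule.mul_mem_mul hx hy
  rw [shorter, shorter, Submodule.span_mul_span] at h
  refine Submodule.span_mono ?_ h
  rintro _ ⟨_, ⟨v, hv, rfl⟩, _, ⟨w, hw, rfl⟩, rfl⟩
  exact ⟨v ++ w, by simp; omega, by simp⟩

theorem pow_mem_shorter {N : ℕ} {x : A} (hx : x ∈ shorter K e (N + 1)) (m : ℕ) :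
    x ^ m ∈ shorter K e (m * N + 1) := by
  induction m with
  | zero => simpa using word_mem_shorter (K := K) (e := e) (w := []) (m := 1) (by simp)
  | succ m ih =>
    rw [pow_succ]
    exact mul_mem_shorter ih hx (by rw [Nat.succ_mul]; omega)

/-- Modulo shorter words, the powers of `α + β + γ` are those of `α` and `β` if the mixed
products `αβ`, `βα` and the remainder `γ` are shorter than expected. -/
theorem add_pow_sub_mem_shorter {N : ℕ} {α β γ : A} (hα : α ∈ shorter K e (N + 1))
    (hβ : β ∈ shorter K e (N + 1)) (hγ : γ ∈ shorter K e N)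
    (hαβ : α * β ∈ shorter K e (N + N)) (hβα : β * α ∈ shorter K e (N + N)) (m : ℕ) :
    (α + β + γ) ^ (m + 1) - α ^ (m + 1) - β ^ (m + 1) ∈ shorter K e ((m + 1) * N) := by
  induction m with
  | zero =>
    have h : α + β + γ - α - β = γ := by abel
    simpa [h] using hγ
  | succ m ih =>
    have key : (α + β + γ) ^ (m + 1 + 1) - α ^ (m + 1 + 1) - β ^ (m + 1 + 1) =
        ((α + β + γ) ^ (m + 1) - α ^ (m + 1) - β ^ (m + 1)) * (α + β + γ) +
          (α ^ (m + 1) * γ + β ^ (m + 1) * γ + α ^ m * (α * β) + β ^ m * (β * α)) := by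
      rw [← mul_assoc, ← mul_assoc, ← pow_succ, ← pow_succ]
      simp only [pow_succ _ (m + 1)]
      noncomm_ring
    have hs : α + β + γ ∈ shorter K e (N + 1) :=
      add_mem (add_mem hα hβ) (shorter_mono (Nat.le_succ N) hγ)
    have e1 : (m + 1 + 1) * N = m * N + N + N := by ring
    have e2 : (m + 1) * N = m * N + N := by ring
    rw [key, e1]
    rw [e2] at ih
    have pα := pow_mem_shorter hα (m + 1)
    have pβ := pow_mem_shorter hβ (m + 1)
    rw [e2] at pα pβ
    refine add_mem (mul_mem_shorter ih hs (by omega)) (add_mem (add_mem (add_mem ?_ ?_) ?_) ?_)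
    · exact mul_mem_shorter pα hγ (by omega)
    · exact mul_mem_shorter pβ hγ (by omega)
    · exact mul_mem_shorter (pow_mem_shorter hα m) hαβ (by omega)
    · exact mul_mem_shorter (pow_mem_shorter hβ m) hβα (by omega)

theorem IsTL.commute_word (H : IsTL q e) {i : Fin (n + 1)} {u : List (Fin (n + 1))}
    (h : ∀ k ∈ u, i ≠ k ∧ ¬ Adj i k) : Commute (e i) (word e u) := by
  refine Commute.list_prod_right _ _ fun x hx => ?_
  obtain ⟨k, hk, rfl⟩ := List.mem_map.1 hx
  exact H.comm i k (h k hk).1 (h k hk).2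

/-- A word `i u i` in which `u` avoids `i` and one of its neighbours can be shortened. -/
theorem IsTL.sandwich_mem (H : IsTL q e) (u : List (Fin (n + 1))) {i j : Fin (n + 1)}
    (hij : Adj i j) (hi : i ∉ u) (hj : j ∉ u) :
    e i * word e u * e i ∈ shorter K e (u.length + 2) := by
  induction hm : u.length using Nat.strong_induction_on generalizing u i j with
  | _ m ih =>
    subst hm
    obtain ⟨j', hij', huniq⟩ := hij.exists_other
    by_cases hj' : j' ∈ u
    · obtain ⟨x, y, rfl, hx⟩ := List.eq_append_cons_of_mem hj'
      have hcx : Commute (e i) (word e x) := H.commute_word fun k hk =>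
        ⟨by rintro rfl; exact hi (by simp [hk]), fun hA => by
          rcases huniq k hA with rfl | rfl
          · exact hj (by simp [hk])
          · exact hx hk⟩
      by_cases hy : j' ∈ y
      · obtain ⟨z, r, rfl, hz⟩ := List.eq_append_cons_of_mem hy
        have h1 := ih z.length (by simp; omega) z hij'.symm hz
          (fun h => hi (by simp [h])) rfl
        have h2 : e i * word e (x ++ j' :: (z ++ j' :: r)) * e i =
            word e (i :: x) * (e j' * word e z * e j') * word e (r ++ [i]) := by
          simp [mul_assoc]
        rw [h2]
        refine mul_mem_shorter (m := r.length + 2) (l := x.length + z.length + 3)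
          (mul_mem_shorter (word_mem_shorter (m := x.length + 2) (by simp)) h1 (by omega))
          (word_mem_shorter (by simp)) ?_
        simp; omega
      · have hcy : Commute (e i) (word e y) := H.commute_word fun k hk =>
          ⟨by rintro rfl; exact hi (by simp [hk]), fun hA => by
            rcases huniq k hA with rfl | rfl
            · exact hj (by simp [hk])
            · exact hy hk⟩
        have h2 : e i * word e (x ++ j' :: y) * e i = q • word e (x ++ i :: y) := by
          calc e i * word e (x ++ j' :: y) * e i
              = (e i * word e x) * e j' * (word e y * e i) := by simp [mul_assoc]
            _ = (word e x * e i) * e j' * (e i * word e y) := by rw [hcx.eq, hcy.eq]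
            _ = word e x * (e i * e j' * e i) * word e y := by simp only [mul_assoc]
            _ = q • word e (x ++ i :: y) := by rw [H.adj i j' hij']; simp [mul_assoc]
        rw [h2]
        exact Submodule.smul_mem _ _ (word_mem_shorter (by simp))
    · have hc : Commute (e i) (word e u) := H.commute_word fun k hk =>
        ⟨by rintro rfl; exact hi hk, fun hA => by
          rcases huniq k hA with rfl | rfl
          · exact hj hk
          · exact hj' hk⟩
      rw [mul_assoc, ← hc.eq, ← mul_assoc, H.sq, smul_mul_assoc, ← word_cons]
      exact Submodule.smul_mem _ _ (word_mem_shorter (by simp))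

/-- The letters of a word equal to `i` or `j`. -/
def restrict (i j : Fin (n + 1)) (w : List (Fin (n + 1))) : List (Fin (n + 1)) :=
  w.filter fun x => decide (x = i ∨ x = j)

/-- Words in which two adjacent letters do not alternate can be shortened. -/
theorem IsTL.word_mem_of_not_isChain (H : IsTL q e) {w : List (Fin (n + 1))} {i j : Fin (n + 1)}
    (hij : Adj i j) (h : ¬ List.IsChain (· ≠ ·) (restrict i j w)) :
    word e w ∈ shorter K e w.length := by
  rw [List.isChain_iff_forall_rel_of_append_cons_cons] at h
  push Not at h
  obtain ⟨a, b, l₁, l₂, h, rfl⟩ := h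
  obtain ⟨w₁, w₂, rfl, -, h⟩ := List.filter_eq_append_iff.1 h
  obtain ⟨x, y, rfl, -, ha, h⟩ := List.filter_eq_cons_iff.1 h
  obtain ⟨u, s, rfl, hu, -, -⟩ := List.filter_eq_cons_iff.1 h
  simp only [decide_eq_true_eq, not_or] at ha hu
  have h1 : ∃ b, Adj a b ∧ a ∉ u ∧ b ∉ u := by
    rcases ha with rfl | rfl
    · exact ⟨j, hij, fun h => (hu _ h).1 rfl, fun h => (hu _ h).2 rfl⟩
    · exact ⟨i, hij.symm, fun h => (hu _ h).2 rfl, fun h => (hu _ h).1 rfl⟩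
  obtain ⟨b, hab, h2, h3⟩ := h1
  have h4 := H.sandwich_mem u hab h2 h3
  have h5 : word e (w₁ ++ (x ++ a :: (u ++ a :: s))) =
      word e (w₁ ++ x) * (e a * word e u * e a) * word e s := by simp [mul_assoc]
  rw [h5]
  refine mul_mem_shorter (l := w₁.length + x.length + u.length + 2) (m := s.length + 1)
    (mul_mem_shorter (l := w₁.length + x.length + 1) (word_mem_shorter (by simp)) h4 (by omega))
    (word_mem_shorter (by simp)) ?_
  simp; omega

/-- Words with the same restrictions to all pairs of adjacent letters agree up to commutations. -/
theorem IsTL.word_eq_of_restrict_eq (H : IsTL q e) (w w' : List (Fin (n + 1)))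
    (h : ∀ i j, Adj i j → restrict i j w = restrict i j w') : word e w = word e w' := by
  induction w generalizing w' with
  | nil =>
    cases w' with
    | nil => rfl
    | cons y t => simpa [restrict] using h y (y + 1) (adj_add_one y)
  | cons x w ih =>
    have hx : x ∈ w' := by
      have h1 : x ∈ restrict x (x + 1) (x :: w) := by simp [restrict]
      rw [h x (x + 1) (adj_add_one x)] at h1
      exact (List.mem_filter.1 h1).1
    obtain ⟨p, s, rfl, hp⟩ := List.eq_append_cons_of_mem hx
    have hpx : ∀ y ∈ p, ¬ Adj x y := by
      intro y hy hxy
      have h1 := h x y hxy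
      have h2 : restrict x y p ≠ [] := List.ne_nil_of_mem (a := y) (by simp [restrict, hy])
      obtain ⟨z, t, hz⟩ := List.exists_cons_of_ne_nil h2
      have h3 : z ∈ p := (List.mem_filter.1 (hz ▸ List.mem_cons_self : z ∈ restrict x y p)).1
      simp only [restrict, List.filter_append] at h1 hz
      rw [hz] at h1
      simp only [List.filter_cons, List.cons_append, true_or, decide_true, if_true,
        List.cons.injEq] at h1
      exact hp (h1.1 ▸ h3)
    have hc : Commute (e x) (word e p) := H.commute_word fun y hy =>
      ⟨fun hxy => hp (hxy ▸ hy), hpx y hy⟩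
    have h1 : word e w = word e (p ++ s) := by
      refine ih _ fun i j hij => ?_
      have h2 := h i j hij
      by_cases hxij : x = i ∨ x = j
      · have h3 : restrict i j p = [] := by
          simp only [restrict, List.filter_eq_nil_iff, decide_eq_true_eq]
          rintro y hy hyij
          rcases hxij with rfl | rfl <;> rcases hyij with rfl | rfl
          · exact hp hy
          · exact hpx _ hy hij
          · exact hpx _ hy hij.symm
          · exact hp hy
        simp only [restrict, List.filter_append] at h2 h3 ⊢
        rw [h3] at h2 ⊢
        simpa [List.filter_cons, hxij] using h2
      · simpa [restrict, List.filter_cons, hxij] using h2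
    rw [word_cons, h1, word_append, word_append, word_cons, ← mul_assoc, hc.eq, mul_assoc]

theorem count_le_of_isChain {i j : Fin (n + 1)} {l : List (Fin (n + 1))}
    (hc : List.IsChain (· ≠ ·) l) (hl : ∀ x ∈ l, x = i ∨ x = j) :
    l.count j ≤ l.count i + 1 ∧ (l.head? ≠ some j → l.count j ≤ l.count i) := by
  induction l generalizing i j with
  | nil => simp
  | cons x t ih =>
    rw [List.isChain_cons] at hc
    have h1 := ih hc.2 (i := i) (j := j) fun y hy => hl y (by simp [hy])
    have h2 := ih hc.2 (i := j) (j := i) fun y hy => (hl y (by simp [hy])).symm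
    by_cases hij : i = j
    · subst hij; simp
    rcases hl x (by simp) with rfl | rfl
    · simp only [List.count_cons_self, List.count_cons_of_ne hij]
      exact ⟨by omega, fun _ => h1.1⟩
    · have h3 := h1.2 fun h => hc.1 x (by simp [h]) rfl
      simp only [List.count_cons_self, List.count_cons_of_ne (Ne.symm hij)]
      exact ⟨by omega, by simp⟩

theorem eq_flatten_replicate_of_isChain {i j : Fin (n + 1)} {l : List (Fin (n + 1))} {k : ℕ}
    (hij : i ≠ j) (hc : List.IsChain (· ≠ ·) l) (hl : ∀ x ∈ l, x = i ∨ x = j)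
    (hi : l.count i = k + 1) (hj : l.count j = k + 1) (hd : l.dedup = [i, j]) :
    l = (List.replicate (k + 1) [i, j]).flatten := by
  induction k generalizing l with
  | zero =>
    have hnd : l.Nodup := List.nodup_iff_count_le_one.2 fun x => by
      by_cases hx : x ∈ l
      · rcases hl x hx with rfl | rfl <;> omega
      · rw [List.count_eq_zero_of_not_mem hx]; omega
    rw [← hd, hnd.dedup]; simp
  | succ k ih =>
    match l, hc with
    | [], _ => simp at hi
    | [x], _ =>
      have h := List.count_le_length (a := i) (l := [x])
      simp only [List.length_singleton] at h
      omega
    | x :: y :: t, hc =>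
      rw [List.isChain_cons_cons] at hc
      have hx := hl x (by simp)
      have hy := hl y (by simp)
      have hti : t.count i = k + 1 ∧ t.count j = k + 1 := by
        have hji := Ne.symm hij
        rcases hx with rfl | rfl <;> rcases hy with rfl | rfl
        · exact absurd rfl hc.1
        · simp [hij, hji] at hi hj; omega
        · simp [hij, hji] at hi hj; omega
        · exact absurd rfl hc.1
      have him : i ∈ t := List.count_pos_iff.1 (by omega)
      have hjm : j ∈ t := List.count_pos_iff.1 (by omega)
      have hmem : ∀ z, z = i ∨ z = j → z ∈ t := by rintro z (rfl | rfl) <;> assumption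
      have ht : t = (List.replicate (k + 1) [i, j]).flatten := by
        refine ih hc.2.tail (fun z hz => hl z (by simp [hz])) hti.1 hti.2 ?_
        rw [← hd, List.dedup_cons_of_mem (by simp [hmem x hx]),
          List.dedup_cons_of_mem (hmem y hy)]
      have hyi : y ≠ i := by
        have := hc.2
        rw [ht, List.replicate_succ] at this
        simp only [List.flatten_cons, List.cons_append, List.isChain_cons_cons] at this
        exact this.1
      have hyj : y = j := hy.resolve_left hyi
      have hxi : x = i := hx.resolve_right fun h => hc.1 (h.trans hyj.symm)
      rw [List.replicate_succ, List.flatten_cons, ← ht, hxi, hyj]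
      rfl

theorem restrict_comm (i j : Fin (n + 1)) (w : List (Fin (n + 1))) :
    restrict i j w = restrict j i w := by
  simp [restrict, or_comm]

theorem dedup_filter {α : Type*} [DecidableEq α] (p : α → Bool) (l : List α) :
    (l.filter p).dedup = l.dedup.filter p := by
  induction l with
  | nil => simp
  | cons x l ih =>
    by_cases hp : p x <;> by_cases hx : x ∈ l <;> simp [hp, hx, ih]

theorem mem_restrict {i j x : Fin (n + 1)} {w : List (Fin (n + 1))} :
    x ∈ restrict i j w ↔ x ∈ w ∧ (x = i ∨ x = j) := by
  simp [restrict]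

theorem restrict_flatten_replicate (i j : Fin (n + 1)) (c : List (Fin (n + 1))) (k : ℕ) :
    restrict i j (List.replicate k c).flatten = (List.replicate k (restrict i j c)).flatten := by
  simp [restrict, List.filter_flatten]

theorem count_restrict_left (i j : Fin (n + 1)) (w : List (Fin (n + 1))) :
    (restrict i j w).count i = w.count i :=
  List.count_filter (by simp)

theorem count_restrict_right (i j : Fin (n + 1)) (w : List (Fin (n + 1))) :
    (restrict i j w).count j = w.count j :=
  List.count_filter (by simp)

theorem Adj.ne (hn : 1 ≤ n) {i j : Fin (n + 1)} (h : Adj i j) : i ≠ j := by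
  have : NeZero n := ⟨by omega⟩
  rintro rfl
  rcases h with h | h <;> simp at h

/-- A word in which all adjacent letters alternate and all letters occur equally often is a
power of a word in which every letter occurs once. -/
theorem IsTL.word_eq_pow (H : IsTL q e) (hn : 1 ≤ n) {w : List (Fin (n + 1))} {k : ℕ}
    (hk : ∀ i, w.count i = k + 1)
    (hc : ∀ i j, Adj i j → List.IsChain (· ≠ ·) (restrict i j w)) :
    word e w = word e w.dedup ^ (k + 1) := by
  rw [← word_flatten_replicate]
  have hw : ∀ i, i ∈ w := fun i => List.count_pos_iff.1 (by rw [hk]; omega)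
  have key : ∀ i j, Adj i j → restrict i j w.dedup = [i, j] →
      restrict i j w = restrict i j (List.replicate (k + 1) w.dedup).flatten := by
    intro i j hij hd
    rw [restrict_flatten_replicate, hd]
    exact eq_flatten_replicate_of_isChain (hij.ne hn) (hc i j hij)
      (fun x hx => (mem_restrict.1 hx).2) (by rw [count_restrict_left, hk])
      (by rw [count_restrict_right, hk]) (by rw [restrict, dedup_filter]; exact hd)
  refine H.word_eq_of_restrict_eq _ _ fun i j hij => ?_
  have hnd : (restrict i j w.dedup).Nodup := w.nodup_dedup.filter _
  have hp : (restrict i j w.dedup).Perm [i, j] := by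
    rw [List.perm_ext_iff_of_nodup hnd (by simp [hij.ne hn])]
    intro x
    simp [mem_restrict, hw]
  have hlen := hp.length_eq
  match hr : restrict i j w.dedup, hlen with
  | [x, y], _ =>
    rw [hr] at hp hnd
    have hx : x = i ∨ x = j := by simpa using hp.subset (show x ∈ [x, y] by simp)
    have hy : y = i ∨ y = j := by simpa using hp.subset (show y ∈ [x, y] by simp)
    have hxy : x ≠ y := by simpa using hnd
    rcases hx with rfl | rfl <;> rcases hy with rfl | rfl
    · exact absurd rfl hxy
    · exact key _ _ hij hr
    · rw [restrict_comm, restrict_comm _ x]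
      exact key _ _ hij.symm (by rw [restrict_comm, hr])
    · exact absurd rfl hxy

theorem adj_iff_val {i j : Fin (n + 1)} : Adj i j ↔
    (j.val = i.val + 1 ∨ i.val = n ∧ j.val = 0) ∨ (i.val = j.val + 1 ∨ j.val = n ∧ i.val = 0) := by
  have h : ∀ i j : Fin (n + 1), j = i + 1 ↔ (j.val = i.val + 1 ∨ i.val = n ∧ j.val = 0) := by
    intro i j
    have hj := j.isLt
    rw [Fin.ext_iff, Fin.val_add_one]
    split_ifs with h
    · simp [h]; omega
    · have : i.val ≠ n := fun h' => h (Fin.ext h')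
      omega
  rw [Adj, h, h]

/-- The list of indices `j - 1, …, 1, 0`. -/
def desc (n j : ℕ) : List (Fin (n + 1)) := (List.range j).reverse.map (Fin.ofNat (n + 1))

theorem desc_succ (j : ℕ) : desc n (j + 1) = Fin.ofNat (n + 1) j :: desc n j := by
  simp [desc, List.range_succ]

theorem val_lt_of_mem_desc {j : ℕ} (hj : j ≤ n) {x : Fin (n + 1)} (hx : x ∈ desc n j) :
    x.val < j := by
  simp only [desc, List.mem_map, List.mem_reverse, List.mem_range] at hx
  obtain ⟨k, hk, rfl⟩ := hx
  simp only [Fin.val_ofNat]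
  rwa [Nat.mod_eq_of_lt (by omega)]

theorem prod_sub_one_sub_word_mem (w : List (Fin (n + 1))) :
    (w.map fun i => e i - 1).prod - word e w ∈ shorter K e w.length := by
  induction w with
  | nil => simp
  | cons i w ih =>
    have h : ((i :: w).map fun i => e i - 1).prod - word e (i :: w) =
        word e [i] * ((w.map fun i => e i - 1).prod - word e w) -
          (((w.map fun i => e i - 1).prod - word e w) + word e w) := by
      simp only [List.map_cons, List.prod_cons, word_cons, word_nil, mul_one]
      noncomm_ring
    rw [h]
    exact sub_mem (mul_mem_shorter (word_mem_shorter (m := 2) (by simp)) ih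
      (by simp; omega)) (add_mem (shorter_mono (by simp) ih) (word_mem_shorter (by simp)))

/-- A functional vanishing on commutators, on Markov elements relative to the subalgebra `R` and
the index `t`, and on the powers of the product of all the generators `e i - 1`. -/
structure MarkovNull [Invertible q] (e : Fin (n + 1) → A) (φ : A →ₗ[K] K) (R : Subalgebra K A)
    (t : Fin (n + 1)) : Prop where
  val_t : t.val + 1 = n
  trace : ∀ x y, φ (x * y) = φ (y * x)
  gen_mem : ∀ i : Fin (n + 1), i.val < t.val → e i ∈ R
  last_mem : e t + e (Fin.last n) - e t * e (Fin.last n) - ⅟q • (e (Fin.last n) * e t) ∈ R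
  zero : ∀ r ∈ R, φ r = 0
  zero_mul : ∀ r ∈ R, ∀ s ∈ R, φ (r * e t * s) = 0
  pow : ∀ k : ℕ, φ (((desc n n ++ [Fin.last n]).map fun i => e i - 1).prod ^ k) = 0

namespace MarkovNull

variable [Invertible q] {φ : A →ₗ[K] K} {R : Subalgebra K A} {t : Fin (n + 1)}

theorem trace_pow (M : MarkovNull (q := q) e φ R t) (x y : A) (k : ℕ) :
    φ ((x * y) ^ k) = φ ((y * x) ^ k) := by
  cases k with
  | zero => simp
  | succ k => rw [pow_succ, ← mul_assoc, mul_pow_mul, M.trace, ← mul_assoc, ← pow_succ']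

theorem word_mem (M : MarkovNull (q := q) e φ R t) {w : List (Fin (n + 1))}
    (h : ∀ x ∈ w, x.val < t.val) : word e w ∈ R := by
  refine list_prod_mem fun x hx => ?_
  obtain ⟨i, hi, rfl⟩ := List.mem_map.1 hx
  exact M.gen_mem i (h i hi)

section Markov

variable (M : MarkovNull (q := q) e φ R t) (H : IsTL q e)

include M in
theorem adj_last : Adj t (Fin.last n) := by
  rw [adj_iff_val, Fin.val_last]
  have := M.val_t
  omega

include M in
theorem gen_top_mul {r : A} (hr : r ∈ R) : φ (e t * r) = 0 := by
  simpa using M.zero_mul 1 (one_mem R) r hr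

include M H in
theorem top_last_mul {r : A} (hr : r ∈ R) : φ (e t * e (Fin.last n) * r) = 0 := by
  have h : e t * e (Fin.last n) * r = e t * r - ⅟q • (e t *
      ((e t + e (Fin.last n) - e t * e (Fin.last n) - ⅟q • (e (Fin.last n) * e t)) * r)) := by
    have h1 : e t * (e t + e (Fin.last n) - e t * e (Fin.last n) -
        ⅟q • (e (Fin.last n) * e t)) = q • (e t - e t * e (Fin.last n)) := by
      simp only [mul_sub, mul_add, mul_smul_comm, ← mul_assoc, H.sq, H.adj _ _ M.adj_last,
        smul_mul_assoc, smul_smul, invOf_mul_self, one_smul, add_smul, add_mul, smul_sub]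
      abel
    rw [← mul_assoc (e t) _ r, h1, smul_mul_assoc, smul_smul, invOf_mul_self, one_smul]
    noncomm_ring
  rw [h, map_sub, map_smul, M.gen_top_mul hr, M.gen_top_mul (mul_mem M.last_mem hr)]
  simp

include M H in
theorem last_top_mul {r : A} (hr : r ∈ R) : φ (e (Fin.last n) * e t * r) = 0 := by
  have h : e (Fin.last n) * e t * r = q • (e t * r -
      (e t + e (Fin.last n) - e t * e (Fin.last n) - ⅟q • (e (Fin.last n) * e t)) * e t * r) := by
    have h1 : (e t + e (Fin.last n) - e t * e (Fin.last n) -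
        ⅟q • (e (Fin.last n) * e t)) * e t = e t - ⅟q • (e (Fin.last n) * e t) := by
      simp only [sub_mul, add_mul, smul_mul_assoc, mul_assoc (e (Fin.last n)), H.sq,
        H.adj _ _ M.adj_last, mul_smul_comm, smul_smul, add_smul, mul_add, one_smul, smul_add,
        invOf_mul_self]
      abel
    rw [h1, ← sub_mul, sub_sub_cancel, smul_mul_assoc, smul_smul, mul_invOf_self, one_smul]
  rw [h, map_smul, map_sub, M.gen_top_mul hr, M.zero_mul _ M.last_mem _ hr]
  simp

include M H in
theorem last_mul {r : A} (hr : r ∈ R) : φ (e (Fin.last n) * r) = 0 := by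
  have h : e (Fin.last n) * r =
      (e t + e (Fin.last n) - e t * e (Fin.last n) - ⅟q • (e (Fin.last n) * e t)) * r - e t * r +
        e t * e (Fin.last n) * r + ⅟q • (e (Fin.last n) * e t * r) := by
    simp only [sub_mul, add_mul, smul_mul_assoc]
    abel
  rw [h]
  simp only [map_add, map_sub, map_smul, M.zero _ (mul_mem M.last_mem hr), M.gen_top_mul hr,
    M.top_last_mul H hr, M.last_top_mul H hr]
  simp

include M in
theorem val_lt_of_ne {x : Fin (n + 1)} (h1 : x ≠ t) (h2 : x ≠ Fin.last n) : x.val < t.val := by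
  have h3 : x.val ≠ t.val := fun h => h1 (Fin.ext h)
  have h4 : x.val ≠ n := fun h => h2 (Fin.ext h)
  have := M.val_t
  omega

include M H in
/-- Words with distinct letters are Markov elements up to commutators. -/
theorem word_eq_zero_of_nodup {w : List (Fin (n + 1))} (hw : w.Nodup) : φ (word e w) = 0 := by
  have htl : t ≠ Fin.last n := by
    intro h
    have h1 := M.val_t
    rw [h, Fin.val_last] at h1
    omega
  have step : ∀ v : List (Fin (n + 1)), (Fin.last n :: v).Nodup →
      φ (word e (Fin.last n :: v)) = 0 := by
    intro v hv
    rw [List.nodup_cons] at hv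
    by_cases ht : t ∈ v
    · obtain ⟨x, y, rfl, hx⟩ := List.eq_append_cons_of_mem ht
      have hy : t ∉ y := (List.nodup_cons.1 (List.nodup_append.1 hv.2).2.1).1
      have hxl : ∀ k ∈ x, k.val < t.val := fun k hk =>
        M.val_lt_of_ne (fun h => hx (h ▸ hk)) (fun h => hv.1 (by simp [← h, hk]))
      have hyl : ∀ k ∈ y, k.val < t.val := fun k hk =>
        M.val_lt_of_ne (fun h => hy (h ▸ hk)) (fun h => hv.1 (by simp [← h, hk]))
      have hR : word e x * word e y ∈ R := mul_mem (M.word_mem hxl) (M.word_mem hyl)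
      have hcomm : ∀ z : List (Fin (n + 1)), (∀ k ∈ z, k.val < t.val) →
          (⟨t.val - 1, by omega⟩ : Fin (n + 1)) ∉ z → Commute (e t) (word e z) := by
        refine fun z hz hp => H.commute_word fun k hk => ?_
        have h1 := hz k hk
        have h2 : k.val ≠ t.val - 1 := fun h => hp (by convert hk; exact h.symm)
        have h3 := M.val_t
        refine ⟨fun h => by rw [h] at h1; omega, fun h => ?_⟩
        rw [adj_iff_val] at h
        omega
      by_cases hp : (⟨t.val - 1, by omega⟩ : Fin (n + 1)) ∈ x
      · have hp' : (⟨t.val - 1, by omega⟩ : Fin (n + 1)) ∉ y := fun h =>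
          (List.nodup_append.1 hv.2).2.2 _ hp _ (List.mem_cons_of_mem _ h) rfl
        have h := M.top_last_mul H hR
        rw [mul_assoc, M.trace] at h
        rw [← h]
        congr 1
        simp only [word_cons, word_append, mul_assoc, (hcomm y hyl hp').eq]
      · rw [← M.last_top_mul H hR]
        congr 1
        simp only [word_cons, word_append, mul_assoc]
        rw [← mul_assoc (word e x), ← (hcomm x hxl hp).eq, mul_assoc]
    · rw [word_cons]
      exact M.last_mul H (M.word_mem fun k hk =>
        M.val_lt_of_ne (fun h => ht (h ▸ hk)) (fun h => hv.1 (h ▸ hk)))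
  by_cases hl : Fin.last n ∈ w
  · obtain ⟨x, y, rfl⟩ := List.append_of_mem hl
    have hp : (Fin.last n :: (y ++ x)).Nodup :=
      (List.Perm.nodup_iff (List.perm_append_comm (l₁ := x) (l₂ := Fin.last n :: y))).1 hw
    rw [← step _ hp, word_append, M.trace]
    simp [mul_assoc]
  · by_cases ht : t ∈ w
    · obtain ⟨x, y, rfl, hx⟩ := List.eq_append_cons_of_mem ht
      have hy : t ∉ y := (List.nodup_cons.1 (List.nodup_append.1 hw).2.1).1
      rw [word_append, word_cons, ← mul_assoc]
      refine M.zero_mul _ (M.word_mem fun k hk => ?_) _ (M.word_mem fun k hk => ?_)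
      · exact M.val_lt_of_ne (fun h => hx (h ▸ hk)) (fun h => hl (by simp [← h, hk]))
      · exact M.val_lt_of_ne (fun h => hy (h ▸ hk)) (fun h => hl (by simp [← h, hk]))
    · exact M.zero _ (M.word_mem fun k hk =>
        M.val_lt_of_ne (fun h => ht (h ▸ hk)) (fun h => hl (h ▸ hk)))

end Markov

section Powers

variable (M : MarkovNull (q := q) e φ R t) (H : IsTL q e) {m : ℕ}
  (hφ : ∀ x ∈ shorter K e ((m + 1) * (n + 1)), φ x = 0)

include M H hφ in
/-- The two orders of the last two generators are interchangeable, since the combination of them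
lying in `R` contributes nothing. -/
theorem top_last_pow_iff {y : List (Fin (n + 1))} (hy : y.length + 1 = n)
    (hyt : ∀ x ∈ y, x.val < t.val) :
    φ ((e t * e (Fin.last n) * word e y) ^ (m + 1)) = 0 ↔
      φ ((e (Fin.last n) * e t * word e y) ^ (m + 1)) = 0 := by
  have hty : t ∉ y := fun h => (hyt t h).ne rfl
  have hly : Fin.last n ∉ y := fun h => by
    have h1 := hyt _ h
    have h2 := M.val_t
    rw [Fin.val_last] at h1
    omega
  have hal := M.adj_last
  have hα : -(e t * e (Fin.last n) * word e y) ∈ shorter K e (n + 1 + 1) := by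
    have := word_mem_shorter (K := K) (e := e) (w := t :: Fin.last n :: y) (m := n + 1 + 1)
      (by simp; omega)
    simpa [mul_assoc] using this
  have hβ : -(⅟q • (e (Fin.last n) * e t * word e y)) ∈ shorter K e (n + 1 + 1) := by
    have := word_mem_shorter (K := K) (e := e) (w := Fin.last n :: t :: y) (m := n + 1 + 1)
      (by simp; omega)
    refine neg_mem (Submodule.smul_mem _ _ ?_)
    simpa [mul_assoc] using this
  have hγ : (e t + e (Fin.last n)) * word e y ∈ shorter K e (n + 1) := by
    rw [add_mul, ← word_cons, ← word_cons]
    exact add_mem (word_mem_shorter (by simp; omega)) (word_mem_shorter (by simp; omega))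
  have mixed : ∀ i j : Fin (n + 1), Adj j i → i ∉ y → j ∉ y →
      (e i * e j * word e y) * (e j * e i * word e y) ∈ shorter K e (n + 1 + (n + 1)) := by
    intro i j hij hi hj
    have h : (e i * e j * word e y) * (e j * e i * word e y) =
        word e [i] * (e j * word e y * e j) * word e (i :: y) := by simp [mul_assoc]
    rw [h]
    exact mul_mem_shorter (l := n + 1 + 1) (m := n + 1) (mul_mem_shorter (l := 2)
      (word_mem_shorter (by simp)) (H.sandwich_mem y hij hj hi) (by omega))
      (word_mem_shorter (by simp; omega)) (by omega)
  have key := hφ _ (add_pow_sub_mem_shorter hα hβ hγ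
    (by rw [neg_mul_neg, mul_smul_comm]; exact Submodule.smul_mem _ _ (mixed _ _ hal.symm hty hly))
    (by rw [neg_mul_neg, smul_mul_assoc]; exact Submodule.smul_mem _ _ (mixed _ _ hal hly hty)) m)
  have hsum : -(e t * e (Fin.last n) * word e y) + -(⅟q • (e (Fin.last n) * e t * word e y)) +
      (e t + e (Fin.last n)) * word e y =
      (e t + e (Fin.last n) - e t * e (Fin.last n) - ⅟q • (e (Fin.last n) * e t)) * word e y := by
    simp only [sub_mul, add_mul, smul_mul_assoc]
    abel
  have hR := M.zero _ (pow_mem (mul_mem M.last_mem (M.word_mem hyt)) (m + 1))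
  rw [hsum, map_sub, map_sub, hR, neg_pow, neg_pow (⅟q • _), smul_pow, ← map_one (algebraMap K A),
    ← map_neg, ← map_pow, ← Algebra.smul_def, ← Algebra.smul_def, map_smul, map_smul, map_smul] at key
  have hu : IsUnit ((-1 : K) ^ (m + 1)) := (isUnit_one.neg).pow _
  have hq : IsUnit (⅟q ^ (m + 1)) := (isUnit_of_invertible ⅟q).pow _
  simp only [smul_eq_mul, zero_sub] at key
  constructor
  · intro h
    rw [h, mul_zero, neg_zero, zero_sub, neg_eq_zero, hu.mul_right_eq_zero,
      hq.mul_right_eq_zero] at key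
    exact key
  · intro h
    rw [h, mul_zero, mul_zero, sub_zero, neg_eq_zero, hu.mul_right_eq_zero] at key
    exact key

include M hφ in
theorem desc_pow : φ ((word e (desc n n) * e (Fin.last n)) ^ (m + 1)) = 0 := by
  have hw : word e (desc n n ++ [Fin.last n]) = word e (desc n n) * e (Fin.last n) := by simp
  have hlen : (desc n n ++ [Fin.last n]).length = n + 1 := by simp [desc]
  have h1 := prod_sub_one_sub_word_mem (K := K) (e := e) (desc n n ++ [Fin.last n])
  have h2 : word e (desc n n ++ [Fin.last n]) ∈ shorter K e (n + 1 + 1) :=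
    word_mem_shorter (by omega)
  rw [hlen] at h1
  have key := hφ _ (add_pow_sub_mem_shorter h2 (zero_mem _) h1 (by simp) (by simp) m)
  rw [add_zero, add_sub_cancel, map_sub, map_sub, M.pow, zero_pow (Nat.succ_ne_zero m), hw] at key
  simpa using key

include M H hφ in
theorem desc_mul_word_pow (d j : ℕ) (hj : j + d = n) (s : List (Fin (n + 1))) (hs : s.Nodup)
    (hmem : ∀ x, x ∈ s ↔ j ≤ x.val ∧ x.val < n) (hlen : s.length = d) :
    φ ((word e (desc n j) * e (Fin.last n) * word e s) ^ (m + 1)) = 0 := by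
  induction d generalizing j s with
  | zero =>
    obtain rfl : j = n := hj
    rw [List.eq_nil_of_length_eq_zero hlen, word_nil, mul_one]
    exact M.desc_pow hφ
  | succ d ih =>
    have hvt := M.val_t
    have hjv : (Fin.ofNat (n + 1) j).val = j := Nat.mod_eq_of_lt (by omega)
    obtain ⟨u, v, rfl⟩ := List.append_of_mem ((hmem (Fin.ofNat (n + 1) j)).2 (by omega))
    rw [List.nodup_middle, List.nodup_cons] at hs
    have hlt : ∀ x, x ∈ u ++ v ↔ j + 1 ≤ x.val ∧ x.val < n := by
      intro x
      have h1 := hmem x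
      simp only [List.mem_append, List.mem_cons] at h1 ⊢
      have h2 : x = Fin.ofNat (n + 1) j ↔ x.val = j := by rw [Fin.ext_iff, hjv]
      constructor
      · intro h
        have h3 := h1.1 (by tauto)
        have h4 : x.val ≠ j := fun h5 => hs.1 (by rw [← h2.2 h5]; simpa using h)
        omega
      · intro h
        have h3 := h1.2 (by omega)
        have h4 : x ≠ Fin.ofNat (n + 1) j := fun h5 => by have := h2.1 h5; omega
        tauto
    have hD : ∀ z : List (Fin (n + 1)), (∀ x ∈ z, x ∈ u ++ v) →
        Commute (word e (desc n j)) (word e z) := by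
      intro z hz
      refine Commute.list_prod_left _ _ fun y hy => ?_
      obtain ⟨k, hk, rfl⟩ := List.mem_map.1 hy
      refine H.commute_word fun x hx => ?_
      have h1 := (hlt x).1 (hz x hx)
      have h2 := val_lt_of_mem_desc (by omega) hk
      refine ⟨by rintro rfl; omega, ?_⟩
      rw [adj_iff_val]
      omega
    have hB : ∀ z : List (Fin (n + 1)), (∀ x ∈ z, x ∈ u ++ v) → t ∉ z →
        Commute (word e (desc n j) * e (Fin.last n)) (word e z) := by
      intro z hz ht
      refine (hD z hz).mul_left (H.commute_word fun x hx => ?_)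
      have h1 := (hlt x).1 (hz x hx)
      have h2 : x.val ≠ t.val := fun h => ht (Fin.ext h ▸ hx)
      refine ⟨by rintro rfl; rw [Fin.val_last] at h1; omega, ?_⟩
      rw [adj_iff_val, Fin.val_last]
      omega
    have hrot : φ ((word e (desc n j) * e (Fin.last n) *
        word e (u ++ Fin.ofNat (n + 1) j :: v)) ^ (m + 1)) =
        φ ((e (Fin.ofNat (n + 1) j) * word e v * (word e (desc n j) * e (Fin.last n)) *
          word e u) ^ (m + 1)) := by
      rw [word_append, ← mul_assoc, M.trace_pow, word_cons]
      simp only [mul_assoc]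
    rw [hrot]
    by_cases ht : t ∈ v
    · obtain ⟨v₁, v₂, rfl⟩ := List.append_of_mem ht
      have hs2 := hs.2
      rw [← List.append_assoc, List.nodup_middle, List.nodup_cons] at hs2
      have htu : t ∉ u := fun h => hs2.1 (by simp [h])
      have ht1 : t ∉ v₁ := fun h => hs2.1 (by simp [h])
      have ht2 : t ∉ v₂ := fun h => hs2.1 (by simp [h])
      have hjt : j < t.val := ((hlt t).1 (by simp)).1
      have hc1 := hB v₁ (by simp +contextual) ht1
      have hc2 := hB v₂ (by simp +contextual) ht2
      have hct : Commute (word e (desc n j)) (e t) := by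
        simpa using hD [t] (by simp)
      have hyt : ∀ x ∈ v₂ ++ u ++ Fin.ofNat (n + 1) j :: v₁ ++ desc n j, x.val < t.val := by
        have aux : ∀ x ∈ u ++ (v₁ ++ t :: v₂), x ≠ t → x.val < t.val := fun x hx hxt => by
          have h1 := (hlt x).1 hx
          have h2 : x.val ≠ t.val := fun h => hxt (Fin.ext h)
          omega
        intro x hx
        simp only [List.mem_append, List.mem_cons] at hx
        rcases hx with ((hx | hx) | rfl | hx) | hx
        · exact aux x (by simp [hx]) fun h => ht2 (h ▸ hx)
        · exact aux x (by simp [hx]) fun h => htu (h ▸ hx)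
        · omega
        · exact aux x (by simp [hx]) fun h => ht1 (h ▸ hx)
        · exact (val_lt_of_mem_desc (by omega) hx).trans hjt
      have hylen : (v₂ ++ u ++ Fin.ofNat (n + 1) j :: v₁ ++ desc n j).length + 1 = n := by
        simp only [List.length_append, List.length_cons, desc, List.length_map,
          List.length_reverse, List.length_range] at hlen ⊢
        omega
      have hleft : e (Fin.ofNat (n + 1) j) * word e (v₁ ++ t :: v₂) *
          (word e (desc n j) * e (Fin.last n)) * word e u =
          (e (Fin.ofNat (n + 1) j) * word e v₁ * word e (desc n j)) *
            (e t * e (Fin.last n) * word e v₂ * word e u) := by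
        calc _ = e (Fin.ofNat (n + 1) j) * word e v₁ * e t *
              (word e v₂ * (word e (desc n j) * e (Fin.last n))) * word e u := by
              simp [mul_assoc]
          _ = e (Fin.ofNat (n + 1) j) * word e v₁ * (e t * word e (desc n j)) *
              e (Fin.last n) * word e v₂ * word e u := by
              rw [← hc2.eq]; simp only [mul_assoc]
          _ = _ := by rw [← hct.eq]; simp only [mul_assoc]
      have hright : (e (Fin.ofNat (n + 1) j) * word e v₁ * word e (desc n j)) *
            (e (Fin.last n) * e t * word e v₂ * word e u) =
          word e (desc n (j + 1)) * e (Fin.last n) * word e (v₁ ++ t :: (v₂ ++ u)) := by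
        calc _ = e (Fin.ofNat (n + 1) j) *
              (word e v₁ * (word e (desc n j) * e (Fin.last n))) * e t * word e v₂ *
                word e u := by simp only [mul_assoc]
          _ = _ := by rw [← hc1.eq, desc_succ]; simp [mul_assoc]
      have hy : word e (v₂ ++ u ++ Fin.ofNat (n + 1) j :: v₁ ++ desc n j) = word e v₂ * word e u *
          (e (Fin.ofNat (n + 1) j) * word e v₁ * word e (desc n j)) := by
        simp [mul_assoc]
      rw [hleft, M.trace_pow, mul_assoc (_ * _) (word e v₂), mul_assoc (_ * _) (_ * _), ← hy,
        M.top_last_pow_iff H hφ hylen hyt, hy, ← mul_assoc, ← mul_assoc (_ * _) (word e v₂),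
        M.trace_pow, hright]
      refine ih (j + 1) (by omega) _ ?_ (fun x => ?_) ?_
      · refine (List.Perm.nodup_iff ?_).1 hs.2
        exact List.perm_append_comm.trans (by simp)
      · rw [← hlt x]
        simp only [List.mem_append, List.mem_cons]
        tauto
      · simp only [List.length_append, List.length_cons] at hlen ⊢
        omega
    · have hc := hB v (by simp +contextual) ht
      rw [mul_assoc (e _), ← hc.eq]
      have h := ih (j + 1) (by omega) (v ++ u) (List.nodup_append_comm.1 hs.2)
        (fun x => by rw [← hlt x, List.mem_append, List.mem_append, or_comm])
        (by simp at hlen ⊢; omega)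
      rw [← h, desc_succ]
      simp only [word_cons, word_append, mul_assoc]

include M H hφ in
theorem word_pow_eq_zero {c : List (Fin (n + 1))} (hc : c.Nodup) (hmem : ∀ i, i ∈ c) :
    φ (word e c ^ (m + 1)) = 0 := by
  have hlen : c.length = n + 1 := by
    rw [((List.perm_ext_iff_of_nodup hc (List.nodup_finRange (n + 1))).2
      (by simp [hmem])).length_eq, List.length_finRange]
  obtain ⟨u, v, rfl⟩ := List.append_of_mem (hmem (Fin.last n))
  rw [List.nodup_middle, List.nodup_cons] at hc
  have hiff : ∀ x : Fin (n + 1), x ∈ v ++ u ↔ 0 ≤ x.val ∧ x.val < n := by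
    intro x
    have h1 := hmem x
    have h2 : x ∈ u ++ v → x ≠ Fin.last n := fun h h' => hc.1 (h' ▸ h)
    have h3 : x.val < n ↔ x ≠ Fin.last n := by
      have := x.isLt
      rw [Ne, Fin.ext_iff, Fin.val_last]
      omega
    simp only [List.mem_append, List.mem_cons] at h1 h2 ⊢
    rw [h3]
    have := Nat.zero_le x.val
    tauto
  have h := M.desc_mul_word_pow H hφ n 0 (zero_add n) (v ++ u) (List.nodup_append_comm.1 hc.2)
    hiff (by simp at hlen ⊢; omega)
  rw [word_append, M.trace_pow, ← h]
  simp [desc, mul_assoc]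

end Powers

theorem word_eq_zero (M : MarkovNull (q := q) e φ R t) (H : IsTL q e) (hn : 1 ≤ n)
    (w : List (Fin (n + 1))) : φ (word e w) = 0 := by
  induction hl : w.length using Nat.strong_induction_on generalizing w with
  | _ l ih =>
    subst hl
    have hφ : ∀ x ∈ shorter K e w.length, φ x = 0 := by
      intro x hx
      have h : shorter K e w.length ≤ LinearMap.ker φ := by
        rw [shorter, Submodule.span_le]
        rintro _ ⟨v, hv, rfl⟩
        exact ih _ hv v rfl
      exact h hx
    by_cases hw : w.Nodup
    · exact M.word_eq_zero_of_nodup H hw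
    by_contra hne
    have hrot : ∀ u v : List (Fin (n + 1)), w = u ++ v → ∀ i j, Adj i j →
        List.IsChain (· ≠ ·) (restrict i j (v ++ u)) := by
      rintro u v rfl i j hij
      by_contra hnc
      have h1 := hφ _ (shorter_mono (by simp; omega) (H.word_mem_of_not_isChain hij hnc))
      rw [word_append, M.trace, ← word_append] at h1
      exact hne h1
    have hch : ∀ i j, Adj i j → List.IsChain (· ≠ ·) (restrict i j w) := by
      simpa using hrot [] w rfl
    have hle : ∀ i j, Adj i j → i ∈ w → w.count j ≤ w.count i := by
      intro i j hij hi
      obtain ⟨u, v, rfl⟩ := List.append_of_mem hi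
      have hch' := hrot u (i :: v) rfl i j hij
      have h1 := (count_le_of_isChain hch' fun x hx => (mem_restrict.1 hx).2).2
        (by simp [restrict, hij.ne hn])
      rw [count_restrict_left, count_restrict_right] at h1
      simp only [List.count_append, List.count_cons] at h1 ⊢
      omega
    have hstep : ∀ i j, Adj i j → 2 ≤ w.count i → w.count j = w.count i := by
      intro i j hij hi
      have h1 := hle i j hij (List.count_pos_iff.1 (by omega))
      have h2 := (count_le_of_isChain (hch i j hij) (i := j) (j := i)
        fun x hx => (mem_restrict.1 hx).2.symm).1
      rw [count_restrict_left, count_restrict_right] at h2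
      exact le_antisymm h1 (hle j i hij.symm (List.count_pos_iff.1 (by omega)))
    rw [List.nodup_iff_count_le_one] at hw
    push Not at hw
    obtain ⟨i₀, hi₀⟩ := hw
    have hcount : ∀ i, w.count i = w.count i₀ := by
      have h0 : w.count 0 = w.count i₀ := by
        have : ∀ i : Fin (n + 1), w.count i = w.count i₀ → w.count 0 = w.count i₀ := by
          intro i
          induction i using Fin.induction with
          | zero => exact id
          | succ i ihi =>
            intro h
            refine ihi ?_
            rw [← h]
            exact hstep _ _ (Or.inr Fin.coeSucc_eq_succ.symm) (by omega)
        exact this i₀ rfl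
      intro i
      induction i using Fin.induction with
      | zero => exact h0
      | succ i ihi =>
        rw [← ihi]
        exact hstep _ _ (Or.inl Fin.coeSucc_eq_succ.symm) (by omega)
    obtain ⟨m, hm⟩ : ∃ m, w.count i₀ = m + 1 := ⟨w.count i₀ - 1, by omega⟩
    have hcm : ∀ i, w.count i = m + 1 := fun i => (hcount i).trans hm
    have hlen : w.length = (m + 1) * (n + 1) := by
      have h := Multiset.toFinset_sum_count_eq (w : Multiset (Fin (n + 1)))
      have hu : (w : Multiset (Fin (n + 1))).toFinset = Finset.univ := by
        ext i
        simp only [Multiset.mem_toFinset, Multiset.mem_coe, Finset.mem_univ, iff_true]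
        exact List.count_pos_iff.1 (by rw [hcm]; omega)
      rw [hu] at h
      simp only [Multiset.coe_count, hcm, Multiset.coe_card, Finset.sum_const, Finset.card_univ,
        Fintype.card_fin, smul_eq_mul] at h
      rw [← h, mul_comm]
    rw [hlen] at hφ
    refine hne ?_
    rw [H.word_eq_pow hn hcm hch]
    exact M.word_pow_eq_zero H hφ w.nodup_dedup fun i =>
      List.mem_dedup.2 (List.count_pos_iff.1 (by rw [hcm]; omega))

end MarkovNull

end Words

section Presentation

variable {K q n}

theorem gg_mul_self (i : Fin (n + 1)) :
    gg K q n i * gg K q n i = (q - 1) • gg K q n i + algebraMap K _ q := by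
  simpa [gg] using RingQuot.mkAlgHom_rel K (ATLRel.quad (K := K) (q := q) i)

theorem add_one_mul_add_one_mul_add_one {A : Type*} [Ring A] [Algebra K A] {x y : A}
    (hx : x * x = (q - 1) • x + algebraMap K _ q) (h : Vel x y = 0) :
    (x + 1) * (y + 1) * (x + 1) = q • (x + 1) := by
  have h1 : (x + 1) * (y + 1) * (x + 1) = Vel x y + x * x + x := by
    rw [Vel]
    noncomm_ring
  rw [h1, h, hx, Algebra.algebraMap_eq_smul_one]
  module

theorem vel_swap {A : Type*} [Ring A] {x y : A} (h : x * y * x = y * x * y) :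
    Vel y x = Vel x y := by
  rw [Vel, Vel, h]
  abel

theorem isTL (hn : 2 ≤ n) : IsTL q fun i => gg K q n i + 1 where
  sq i := by
    have h : (gg K q n i + 1) * (gg K q n i + 1) =
        gg K q n i * gg K q n i + 2 • gg K q n i + 1 := by noncomm_ring
    rw [h, gg_mul_self, Algebra.algebraMap_eq_smul_one]
    module
  comm i j hij hA := by
    have key : ∀ i j : Fin (n + 1), i.val < j.val → ¬ Adj i j →
        Commute (gg K q n i) (gg K q n j) := by
      intro i j hlt hA
      rw [adj_iff_val] at hA
      by_cases hj : j.val = n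
      · obtain rfl : j = Fin.last n := Fin.ext hj
        simpa [gg, Commute, SemiconjBy] using
          RingQuot.mkAlgHom_rel K (ATLRel.comm_sa (K := K) (q := q) hn i (by omega) (by omega))
      · simpa [gg, Commute, SemiconjBy] using
          RingQuot.mkAlgHom_rel K (ATLRel.comm_ss (K := K) (q := q) i j (by omega) (by omega)
            (by rw [Nat.dist_eq_sub_of_le hlt.le]; omega))
    have h : Commute (gg K q n i) (gg K q n j) := by
      rcases Nat.lt_or_gt_of_ne (fun h => hij (Fin.ext h)) with h | h
      · exact key i j h hA
      · exact (key j i h fun h' => hA h'.symm).symm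
    exact (h.add_left (Commute.one_left _)).add_right (Commute.one_right _)
  adj i j hA := by
    have key : ∀ i j : Fin (n + 1), i.val < j.val → Adj i j →
        Vel (gg K q n i) (gg K q n j) = 0 ∧ Vel (gg K q n j) (gg K q n i) = 0 := by
      intro i j hlt hA
      rw [adj_iff_val] at hA
      have h : Vel (gg K q n i) (gg K q n j) = 0 ∧ gg K q n i * gg K q n j * gg K q n i =
          gg K q n j * gg K q n i * gg K q n j := by
        by_cases hj : j.val = n
        · obtain rfl : j = Fin.last n := Fin.ext hj
          refine ⟨?_, by simpa [gg] using
            RingQuot.mkAlgHom_rel K (ATLRel.braid_sa (K := K) (q := q) hn i (by omega))⟩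
          by_cases hi : i.val = 0
          · simpa [gg, Vel] using
              RingQuot.mkAlgHom_rel K (ATLRel.v_s1a (K := K) (q := q) hn i hi)
          · simpa [gg, Vel] using
              RingQuot.mkAlgHom_rel K (ATLRel.v_sna (K := K) (q := q) hn i (by omega))
        · exact ⟨by simpa [gg, Vel] using
            RingQuot.mkAlgHom_rel K (ATLRel.v_ss (K := K) (q := q) i j (by omega) (by omega)),
            by simpa [gg] using
            RingQuot.mkAlgHom_rel K (ATLRel.braid_ss (K := K) (q := q) i j (by omega) (by omega))⟩
      exact ⟨h.1, (vel_swap h.2).trans h.1⟩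
    have hne : i.val ≠ j.val := fun h => hA.ne (by omega) (Fin.ext h)
    refine add_one_mul_add_one_mul_add_one (gg_mul_self i) ?_
    rcases Nat.lt_or_gt_of_ne hne with h | h
    · exact (key i j h hA).1
    · exact (key j i h hA.symm).2

theorem eq_zero_of_word {φ : TLhat K q n →ₗ[K] K}
    (h : ∀ w, φ (word (fun i => gg K q n i + 1) w) = 0) : φ = 0 := by
  set S := Submodule.span K (Set.range (word fun i => gg K q n i + 1)) with hS
  have key : ∀ (a : FreeAlgebra K (Fin (n + 1))), ∀ s ∈ S,
      RingQuot.mkAlgHom K (ATLRel K q n) a * s ∈ S := by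
    intro a
    induction a using FreeAlgebra.induction with
    | grade0 r =>
      intro s hs
      rw [AlgHom.commutes, ← Algebra.smul_def]
      exact S.smul_mem r hs
    | grade1 i =>
      have hi : S ≤ S.comap (LinearMap.mulLeft K (gg K q n i)) := by
        rw [hS, Submodule.span_le]
        rintro _ ⟨w, rfl⟩
        have hw : gg K q n i * word (fun i => gg K q n i + 1) w =
            word (fun i => gg K q n i + 1) (i :: w) - word (fun i => gg K q n i + 1) w := by
          rw [word_cons, add_mul, one_mul, add_sub_cancel_right]
        change gg K q n i * word (fun i => gg K q n i + 1) w ∈ Submodule.span K _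
        rw [hw]
        exact sub_mem (Submodule.subset_span ⟨_, rfl⟩) (Submodule.subset_span ⟨_, rfl⟩)
      exact fun s hs => hi hs
    | mul a b ha hb =>
      intro s hs
      rw [map_mul, mul_assoc]
      exact ha _ (hb _ hs)
    | add a b ha hb =>
      intro s hs
      rw [map_add, add_mul]
      exact add_mem (ha _ hs) (hb _ hs)
  have hker : S ≤ LinearMap.ker φ := by
    rw [hS, Submodule.span_le]
    rintro _ ⟨w, rfl⟩
    exact h w
  refine LinearMap.ext fun x => ?_
  obtain ⟨a, rfl⟩ := RingQuot.mkAlgHom_surjective K (ATLRel K q n) x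
  simpa using hker (key a 1 (Submodule.subset_span ⟨[], word_nil⟩))

theorem xel_eq : Xel K q n = ((desc n n ++ [Fin.last n]).map (gg K q n)).prod := by
  rw [Xel, List.map_append, List.prod_append]
  congr 2
  · refine List.ext_getElem (by simp [desc]) fun i h1 h2 => ?_
    simp only [desc, List.getElem_ofFn, List.getElem_map, List.getElem_reverse,
      List.getElem_range, List.length_range]
    congr 1
    refine Fin.ext ?_
    simp only [Fin.val_ofNat]
    rw [Nat.mod_eq_of_lt (by omega)]
  · simp

theorem markovNull [Invertible q] (hn : 2 ≤ n) {F : TLhat K q (n - 1) →ₐ[K] TLhat K q n}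
    (hF : IsF K q n F) {φ : TLhat K q n →ₗ[K] K} (hφ : ∀ x y, φ (x * y) = φ (y * x))
    (hM : ∀ M, IsMarkov K q n F M → φ M = 0) (hX : ∀ k : ℕ, φ (Xel K q n ^ k) = 0) :
    MarkovNull (q := q) (fun i => gg K q n i + 1) φ F.range (sigmaTop n) where
  val_t := by simp [sigmaTop]; omega
  trace := hφ
  gen_mem i hi := by
    refine add_mem ⟨gg K q (n - 1) ⟨i.val, ?_⟩, ?_⟩ (one_mem _)
    · simp [sigmaTop] at hi; omega
    · exact hF.1 _ hi
  last_mem := by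
    have h : gg K q n (sigmaTop n) + 1 + (gg K q n (Fin.last n) + 1) -
        (gg K q n (sigmaTop n) + 1) * (gg K q n (Fin.last n) + 1) -
        ⅟q • ((gg K q n (Fin.last n) + 1) * (gg K q n (sigmaTop n) + 1)) =
        F (gg K q (n - 1) (Fin.last (n - 1))) + 1 := by
      have hA : Adj (sigmaTop n) (Fin.last n) := by
        simp only [adj_iff_val, Fin.val_last, sigmaTop]
        omega
      have hadj := (isTL (K := K) (q := q) hn).adj _ _ hA
      have hquad := gg_mul_self (K := K) (q := q) (sigmaTop n)
      rw [hF.2, ggInv]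
      rw [Algebra.algebraMap_eq_smul_one] at hquad ⊢
      generalize gg K q n (sigmaTop n) = x at *
      generalize gg K q n (Fin.last n) = y at *
      have hxyx : x * y * x = q • (x + 1) - x * x - x - (x * y + y * x + x + y + 1) := by
        rw [← hadj]
        noncomm_ring
      rw [hquad] at hxyx
      rw [mul_smul_comm, mul_sub, hxyx, mul_smul_comm, mul_one]
      simp only [add_mul, mul_add, mul_one, one_mul]
      have hq := invOf_mul_self q
      match_scalars <;> grind
    rw [h]
    exact add_mem ⟨_, rfl⟩ (one_mem _)
  zero := by
    rintro _ ⟨r, rfl⟩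
    exact hM _ ⟨r, 1, 0, by omega, by simp⟩
  zero_mul := by
    rintro _ ⟨r, rfl⟩ _ ⟨s, rfl⟩
    have h1 := hM _ ⟨r, s, 1, by omega, rfl⟩
    have h0 := hM _ ⟨r, s, 0, by omega, rfl⟩
    rw [pow_one] at h1
    rw [pow_zero, mul_one] at h0
    change φ (F r * (_ + 1) * F s) = 0
    rw [mul_add, mul_one, add_mul, map_add, h1, h0, add_zero]
  pow k := by
    simpa [xel_eq] using hX k

end Presentation

end AffineTL

/-- Lemma 5.1.4: a trace on `TL̂_{n+1}(q)` is uniquely determined by its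
values on Markov elements together with its values on the powers `X^k`, `k ≥ 0`. -/
theorem lemma_5_1_4
    (K : Type*) [CommRing K] [IsDomain K] [CharZero K]
    (q sq : K) [Invertible q] [Invertible (q + 1)] (hsq : sq * sq = q)
    (n : ℕ) (hn : 2 ≤ n)
    (F : TLhat K q (n - 1) →ₐ[K] TLhat K q n) (hF : IsF K q n F)
    (τ τ' : TLhat K q n →ₗ[K] K) (hτ : IsTrace K τ) (hτ' : IsTrace K τ')
    (hM : ∀ M : TLhat K q n, IsMarkov K q n F M → τ M = τ' M)
    (hX : ∀ k : ℕ, τ (Xel K q n ^ k) = τ' (Xel K q n ^ k)) :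
    τ = τ' := by
  rw [← sub_eq_zero]
  have M := AffineTL.markovNull hn hF (φ := τ - τ')
    (fun x y => by simp [hτ x y, hτ' x y])
    (fun x hx => by simp [hM x hx]) (fun k => by simp [hX k])
  exact AffineTL.eq_zero_of_word fun w => M.word_eq_zero (AffineTL.isTL hn) (by omega) w
end

section
/- Let r, s be positive integers with r ≤ s. Then there exist h ≤ s, elements c_0,…,c_h in the image of F, and a K-linear combination M of Markov elements such that every trace τ_3 on TL̂_3(q) satisfies τ_3( (g_{σ_1}F(t_{a_2}))^r · g_{σ_1}g_{σ_2} · (g_{σ_1}F(t_{a_2}))^s · g_{σ_1}g_{σ_2} ) = τ_3( Σ_{j=0}^{h} c_j·Y^j + M ). -/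
open FreeAlgebra

variable (K : Type*) [CommRing K] (q : K) (n : ℕ)

/-- The elements of an algebra on which every trace agrees with some element of a given
submodule `N`. -/
def traceClosure {K R : Type*} [CommRing K] [Ring R] [Algebra K R] (N : Submodule K R) :
    Submodule K R where
  carrier := {r | ∃ m ∈ N, ∀ τ : R →ₗ[K] K, IsTrace K τ → τ r = τ m}
  zero_mem' := ⟨0, N.zero_mem, fun _ _ => rfl⟩
  add_mem' := by
    rintro x y ⟨m, hm, h⟩ ⟨m', hm', h'⟩
    exact ⟨m + m', N.add_mem hm hm', fun τ hτ => by rw [map_add, map_add, h τ hτ, h' τ hτ]⟩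
  smul_mem' := by
    rintro k x ⟨m, hm, h⟩
    exact ⟨k • m, N.smul_mem k hm, fun τ hτ => by rw [map_smul, map_smul, h τ hτ]⟩

theorem le_traceClosure {K R : Type*} [CommRing K] [Ring R] [Algebra K R]
    (N : Submodule K R) : N ≤ traceClosure N :=
  fun r hr => ⟨r, hr, fun _ _ => rfl⟩

theorem mul_comm_mem_traceClosure {K R : Type*} [CommRing K] [Ring R] [Algebra K R]
    (N : Submodule K R) {x y : R} (h : x * y ∈ traceClosure N) : y * x ∈ traceClosure N := by
  obtain ⟨m, hm, h⟩ := h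
  exact ⟨m, hm, fun τ hτ => by rw [hτ y x, h τ hτ]⟩

section TemperleyLieb

variable {K R : Type*} [CommRing K] [Ring R] [Algebra K R]

theorem mul_mul_eq_of_mul_eq {q δ : K} (hδ : IsUnit δ) {a b X : R}
    (hab : a * b * a = q • a) (hX : a * X = δ • X) : a * (b * X) = q • X := by
  apply (hδ.smul_left_cancel (a := δ)).1
  rw [← mul_smul_comm, ← mul_smul_comm, ← hX, ← mul_assoc, ← mul_assoc, hab,
    smul_mul_assoc, hX, smul_comm]

/-- Let `a`, `b`, `e` be Temperley–Lieb generators of an algebra `R`, pairwise linked, and let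
`S` be a submodule stable under cyclic permutation of products. If `S` contains `A` and `A b` for
a subalgebra `A` containing `a` and `q b + q e - q b e - e b`, then `S` is everything. -/
theorem mem_of_temperleyLieb {q : K} (hq : IsUnit q) (hδ : IsUnit (q + 1)) {a b e : R}
    (haa : a * a = (q + 1) • a) (hbb : b * b = (q + 1) • b) (hee : e * e = (q + 1) • e)
    (haba : a * b * a = q • a) (hbab : b * a * b = q • b)
    (haea : a * e * a = q • a) (heae : e * a * e = q • e)
    (hbeb : b * e * b = q • b) (hebe : e * b * e = q • e)
    (hgen : ∀ P : Submodule K R, 1 ∈ P →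
      (∀ x ∈ P, a * x ∈ P ∧ b * x ∈ P ∧ e * x ∈ P) → ∀ r, r ∈ P)
    (S : Submodule K R) (hS : ∀ x y, x * y ∈ S → y * x ∈ S)
    (A : Subalgebra K R) (ha : a ∈ A) (hv : q • b + q • e - q • (b * e) - e * b ∈ A)
    (hAS : ∀ x ∈ A, x ∈ S) (hAbS : ∀ x ∈ A, x * b ∈ S) (r : R) : r ∈ S := by
  have smul_mem_iff (N : Submodule K R) {k : K} (hk : IsUnit k) {x : R} (h : k • x ∈ N) :
      x ∈ N := (N.smul_mem_iff_of_isUnit hk).1 h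
  obtain ⟨v, hvd⟩ : ∃ v, v = q • b + q • e - q • (b * e) - e * b := ⟨_, rfl⟩
  rw [← hvd] at hv
  have hab {X : R} (hX : a * X = (q + 1) • X) : a * (b * X) = q • X :=
    mul_mul_eq_of_mul_eq hδ haba hX
  have hae {X : R} (hX : a * X = (q + 1) • X) : a * (e * X) = q • X :=
    mul_mul_eq_of_mul_eq hδ haea hX
  have haa' (X : R) : a * (a * X) = (q + 1) • (a * X) := by rw [← mul_assoc, haa, smul_mul_assoc]
  have hbb' (X : R) : b * (b * X) = (q + 1) • (b * X) := by rw [← mul_assoc, hbb, smul_mul_assoc]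
  have hee' (X : R) : e * (e * X) = (q + 1) • (e * X) := by rw [← mul_assoc, hee, smul_mul_assoc]
  have hbab' (X : R) : b * (a * (b * X)) = q • (b * X) := by
    rw [← mul_assoc, ← mul_assoc, hbab, smul_mul_assoc]
  have heae' (X : R) : e * (a * (e * X)) = q • (e * X) := by
    rw [← mul_assoc, ← mul_assoc, heae, smul_mul_assoc]
  have hbeb' (X : R) : b * (e * (b * X)) = q • (b * X) := by
    rw [← mul_assoc, ← mul_assoc, hbeb, smul_mul_assoc]
  have hebe' (X : R) : e * (b * (e * X)) = q • (e * X) := by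
    rw [← mul_assoc, ← mul_assoc, hebe, smul_mul_assoc]
  have huX {X : R} (hX : a * X = (q + 1) • X) :
      a * (v * X) = (2 * q ^ 2) • X - q • (a * (b * (e * X))) - a * (e * (b * X)) := by
    simp only [hvd, sub_mul, add_mul, mul_sub, mul_add, smul_mul_assoc, mul_smul_comm, mul_assoc,
      hab hX, hae hX]
    module
  have hcd {X : R} (hX : a * X = (q + 1) • X) :
      a * (b * (e * (a * (e * (b * X))))) = q ^ 3 • X := by
    simp only [heae', hbeb', mul_smul_comm, hab hX]
    module
  have hdc {X : R} (hX : a * X = (q + 1) • X) :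
      a * (e * (b * (a * (b * (e * X))))) = q ^ 3 • X := by
    simp only [hbab', hebe', mul_smul_comm, hae hX]
    module
  have havb {X : R} (hX : a * X = (q + 1) • X) :
      a * (v * (b * X)) = q ^ 2 • X - a * (e * (b * X)) := by
    simp only [hvd, sub_mul, add_mul, mul_sub, mul_add, smul_mul_assoc, mul_smul_comm, mul_assoc,
      hbb', hbeb', hab hX]
    module
  have hua (k : ℕ) : a * ((a * v) ^ k * a) = (q + 1) • ((a * v) ^ k * a) := by
    cases k with
    | zero => simpa using haa
    | succ k => simp only [pow_succ', mul_assoc, haa']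
  have hus (k : ℕ) : a * (v * ((a * v) ^ k * a)) = (a * v) ^ (k + 1) * a := by
    simp only [pow_succ', mul_assoc]
  have huA (k : ℕ) : (a * v) ^ k ∈ A := pow_mem (mul_mem ha hv) k
  let J : Submodule K R := Submodule.span K
    (Set.range (fun k : ℕ => (a * v) ^ k * a) ∪
      Set.range fun k : ℕ => a * (e * (b * ((a * v) ^ k * a))))
  have hJu (k : ℕ) : (a * v) ^ k * a ∈ J := Submodule.subset_span (.inl ⟨k, rfl⟩)
  have hJdu (k : ℕ) : a * (e * (b * ((a * v) ^ k * a))) ∈ J :=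
    Submodule.subset_span (.inr ⟨k, rfl⟩)
  have hJa {X : R} (hX : X ∈ J) : a * X = (q + 1) • X := by
    induction hX using Submodule.span_induction with
    | mem x hx =>
      rcases hx with ⟨k, rfl⟩ | ⟨k, rfl⟩
      · exact hua k
      · exact haa' _
    | zero => simp
    | add x y _ _ hx hy => rw [mul_add, hx, hy, smul_add]
    | smul k x _ hx => rw [mul_smul_comm, hx, smul_comm]
  have hJd {X : R} (hX : X ∈ J) : a * (e * (b * X)) ∈ J := by
    induction hX using Submodule.span_induction with
    | mem x hx =>
      rcases hx with ⟨k, rfl⟩ | ⟨k, rfl⟩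
      · exact hJdu k
      · have h := congrArg (fun t => a * (e * (b * t))) (huX (hua k))
        simp only [mul_sub, mul_smul_comm, hdc (hua k), hus] at h
        rw [eq_sub_iff_add_eq, ← eq_sub_iff_add_eq'] at h
        rw [h]
        exact J.sub_mem (J.sub_mem (J.smul_mem _ (hJdu k))
          (J.smul_mem _ (J.smul_mem _ (hJu k)))) (hJdu _)
    | zero => simp
    | add x y _ _ hx hy => simp only [mul_add]; exact J.add_mem hx hy
    | smul k x _ hx => simp only [mul_smul_comm]; exact J.smul_mem k hx
  have hJc {X : R} (hX : X ∈ J) : a * (b * (e * X)) ∈ J := by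
    induction hX using Submodule.span_induction with
    | mem x hx =>
      rcases hx with ⟨k, rfl⟩ | ⟨k, rfl⟩
      · have h := huX (hua k)
        apply smul_mem_iff J hq
        rw [sub_right_comm, eq_sub_iff_add_eq, ← eq_sub_iff_add_eq', hus] at h
        rw [h]
        exact J.sub_mem (J.sub_mem (J.smul_mem _ (hJu k)) (hJdu k)) (hJu _)
      · simp only [hcd (hua k)]
        exact J.smul_mem _ (hJu k)
    | zero => simp
    | add x y _ _ hx hy => simp only [mul_add]; exact J.add_mem hx hy
    | smul k x _ hx => simp only [mul_smul_comm]; exact J.smul_mem k hx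
  have hJS : J ≤ S := by
    refine Submodule.span_le.2 ?_
    rintro _ (⟨k, rfl⟩ | ⟨k, rfl⟩)
    · exact hAS _ (mul_mem (huA k) ha)
    · have h1 : ((a * v) ^ k * a) * (a * (v * b)) ∈ S := by
        rw [mul_assoc, haa', mul_smul_comm]
        refine S.smul_mem _ ?_
        have := hAbS _ (huA (k + 1))
        simpa only [pow_succ, mul_assoc] using this
      have h2 := hS _ _ h1
      rw [mul_assoc, mul_assoc, havb (hua k)] at h2
      exact (S.sub_mem_iff_right (S.smul_mem _ (hAS _ (mul_mem (huA k) ha)))).1 h2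
  let L : Submodule K R :=
    J ⊔ J.map (LinearMap.mulLeft K b) ⊔ J.map (LinearMap.mulLeft K e)
  have hLJ {X : R} (hX : X ∈ J) : X ∈ L := Submodule.mem_sup_left (Submodule.mem_sup_left hX)
  have hLb {X : R} (hX : X ∈ J) : b * X ∈ L :=
    Submodule.mem_sup_left (Submodule.mem_sup_right ⟨X, hX, rfl⟩)
  have hLe {X : R} (hX : X ∈ J) : e * X ∈ L := Submodule.mem_sup_right ⟨X, hX, rfl⟩
  have hL {x : R} (hx : x ∈ L) : ∃ X ∈ J, ∃ Y ∈ J, ∃ Z ∈ J, x = X + b * Y + e * Z := by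
    obtain ⟨_, h, _, ⟨Z, hZ, rfl⟩, rfl⟩ := Submodule.mem_sup.1 hx
    obtain ⟨X, hX, _, ⟨Y, hY, rfl⟩, rfl⟩ := Submodule.mem_sup.1 h
    exact ⟨X, hX, Y, hY, Z, hZ, rfl⟩
  have haL {x : R} (hx : x ∈ L) : a * x ∈ J := by
    obtain ⟨X, hX, Y, hY, Z, hZ, rfl⟩ := hL hx
    rw [mul_add, mul_add, hJa hX, hab (hJa hY), hae (hJa hZ)]
    exact J.add_mem (J.add_mem (J.smul_mem _ hX) (J.smul_mem _ hY)) (J.smul_mem _ hZ)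
  have hRa (r : R) : r * a ∈ L := by
    refine hgen (L.comap (LinearMap.mulRight K a)) (hLJ (by simpa using hJu 0)) ?_ r
    intro x hx
    simp only [Submodule.mem_comap, LinearMap.mulRight_apply, mul_assoc] at hx ⊢
    refine ⟨hLJ (haL hx), ?_⟩
    obtain ⟨X, hX, Y, hY, Z, hZ, h⟩ := hL hx
    simp only [h, mul_add, hbb', hee']
    constructor
    · refine L.add_mem (L.add_mem (hLb hX) (L.smul_mem _ (hLb hY))) (smul_mem_iff L hq ?_)
      rw [← hbab']
      exact hLb (hJc hZ)
    · refine L.add_mem (L.add_mem (hLe hX) (smul_mem_iff L hq ?_)) (L.smul_mem _ (hLe hZ))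
      rw [← heae']
      exact hLe (hJd hY)
  have hRaS (r : R) : r * a ∈ S := by
    apply smul_mem_iff S hδ
    rw [← mul_smul_comm, ← haa, ← mul_assoc]
    exact hS _ _ (hJS (haL (hRa r)))
  let I : Submodule K R := Submodule.span K {x | ∃ y z, x = y * a * z}
  have hIa (y z : R) : y * a * z ∈ I := Submodule.subset_span ⟨y, z, rfl⟩
  have hI (g : R) {x : R} (hx : x ∈ I) : g * x ∈ I := by
    induction hx using Submodule.span_induction with
    | mem x hx =>
      obtain ⟨y, z, rfl⟩ := hx
      simpa only [mul_assoc] using hIa (g * y) z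
    | zero => simp
    | add x y _ _ hx hy => rw [mul_add]; exact I.add_mem hx hy
    | smul k x _ hx => rw [mul_smul_comm]; exact I.smul_mem k hx
  have hIS : I ≤ S := by
    refine Submodule.span_le.2 ?_
    rintro _ ⟨y, z, rfl⟩
    apply hS
    rw [← mul_assoc]
    exact hRaS _
  have h1I {g : R} (hg : g ∈ I) {x : R} (hx : x ∈ K ∙ (1 : R) ⊔ I) : g * x ∈ K ∙ (1 : R) ⊔ I := by
    obtain ⟨_, h, y, hy, rfl⟩ := Submodule.mem_sup.1 hx
    obtain ⟨k, rfl⟩ := Submodule.mem_span_singleton.1 h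
    refine Submodule.mem_sup_right ?_
    rw [mul_add, mul_smul_comm, mul_one]
    exact I.add_mem (I.smul_mem k hg) (hI g hy)
  have haI : a ∈ I := by simpa using hIa 1 1
  have hbI : b ∈ I := smul_mem_iff I hq (hbab ▸ hIa b b)
  have heI : e ∈ I := smul_mem_iff I hq (heae ▸ hIa e e)
  have hr : r ∈ K ∙ (1 : R) ⊔ I := hgen _
    (Submodule.mem_sup_left (Submodule.mem_span_singleton_self 1)) (fun x hx => ⟨h1I haI hx, h1I hbI hx, h1I heI hx⟩) r
  have h1S : K ∙ (1 : R) ≤ S := by simpa using hAS 1 A.one_mem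
  exact sup_le h1S hIS hr

end TemperleyLieb

theorem add_one_mul_self_of_quadratic {K R : Type*} [CommRing K] [Ring R] [Algebra K R] {q : K}
    {x : R} (h : x * x = (q - 1) • x + algebraMap K R q) :
    (x + 1) * (x + 1) = (q + 1) • (x + 1) := by
  rw [Algebra.algebraMap_eq_smul_one] at h
  simp only [mul_add, add_mul, h, mul_one, one_mul]
  module

theorem add_one_mul_mul_of_Vel {K R : Type*} [CommRing K] [Ring R] [Algebra K R] {q : K}
    {x y : R} (h : x * x = (q - 1) • x + algebraMap K R q) (hV : Vel x y = 0) :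
    (x + 1) * (y + 1) * (x + 1) = q • (x + 1) := by
  have h2 : (x + 1) * (y + 1) * (x + 1) = Vel x y + x * x + x := by
    unfold Vel
    noncomm_ring
  rw [h2, hV, h, Algebra.algebraMap_eq_smul_one]
  module

theorem Vel_comm_of_braid {R : Type*} [Ring R] {x y : R} (h : x * y * x = y * x * y) :
    Vel x y = Vel y x := by
  unfold Vel
  rw [h]
  abel

theorem gg_mul_self (K : Type*) [CommRing K] (q : K) (n : ℕ) (i : Fin (n + 1)) :
    gg K q n i * gg K q n i = (q - 1) • gg K q n i + algebraMap K _ q := by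
  simpa [gg] using RingQuot.mkAlgHom_rel K (ATLRel.quad (q := q) i)

theorem mkAlgHom_Vel {K A B : Type*} [CommRing K] [Ring A] [Ring B] [Algebra K A] [Algebra K B]
    (f : A →ₐ[K] B) (x y : A) : f (Vel x y) = Vel (f x) (f y) := by
  simp [Vel]

theorem mem_of_gg_mul_mem {K : Type*} [CommRing K] {q : K} {n : ℕ}
    (P : Submodule K (TLhat K q n)) (h1 : 1 ∈ P) (h : ∀ i, ∀ x ∈ P, gg K q n i * x ∈ P)
    (r : TLhat K q n) : r ∈ P := by
  obtain ⟨f, rfl⟩ := RingQuot.mkAlgHom_surjective K (ATLRel K q n) r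
  suffices ∀ x ∈ P, RingQuot.mkAlgHom K (ATLRel K q n) f * x ∈ P by simpa using this 1 h1
  induction f using FreeAlgebra.induction with
  | grade0 k =>
    intro x hx
    rw [AlgHom.commutes, ← Algebra.smul_def]
    exact P.smul_mem k hx
  | grade1 i => exact h i
  | mul f g hf hg =>
    intro x hx
    rw [map_mul, mul_assoc]
    exact hf _ (hg _ hx)
  | add f g hf hg =>
    intro x hx
    rw [map_add, add_mul]
    exact P.add_mem (hf _ hx) (hg _ hx)

/-- Modulo commutators, `TL̂_3(q)` is spanned by Markov elements. -/
theorem mem_traceClosure_span_isMarkov {K : Type*} [CommRing K] {q : K}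
    [Invertible q] [Invertible (q + 1)] {F : TLhat K q 1 →ₐ[K] TLhat K q 2} (hF : IsF K q 2 F)
    (r : TLhat K q 2) :
    r ∈ traceClosure (Submodule.span K {x : TLhat K q 2 | IsMarkov K q 2 F x}) := by
  have hb01 : gg K q 2 0 * gg K q 2 1 * gg K q 2 0 = gg K q 2 1 * gg K q 2 0 * gg K q 2 1 := by
    simpa [gg] using RingQuot.mkAlgHom_rel K
      (ATLRel.braid_ss (K := K) (q := q) (n := 2) 0 1 (by simp) (by simp))
  have hb02 : gg K q 2 0 * gg K q 2 2 * gg K q 2 0 = gg K q 2 2 * gg K q 2 0 * gg K q 2 2 := by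
    simpa [gg] using RingQuot.mkAlgHom_rel K
      (ATLRel.braid_sa (K := K) (q := q) (n := 2) le_rfl 0 (by simp))
  have hb12 : gg K q 2 1 * gg K q 2 2 * gg K q 2 1 = gg K q 2 2 * gg K q 2 1 * gg K q 2 2 := by
    simpa [gg] using RingQuot.mkAlgHom_rel K
      (ATLRel.braid_sa (K := K) (q := q) (n := 2) le_rfl 1 (by simp))
  have hv01 : Vel (gg K q 2 0) (gg K q 2 1) = 0 := by
    simpa [gg, mkAlgHom_Vel] using RingQuot.mkAlgHom_rel K
      (ATLRel.v_ss (K := K) (q := q) (n := 2) 0 1 (by simp) (by simp))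
  have hv02 : Vel (gg K q 2 0) (gg K q 2 2) = 0 := by
    simpa [gg, mkAlgHom_Vel] using RingQuot.mkAlgHom_rel K
      (ATLRel.v_s1a (K := K) (q := q) (n := 2) le_rfl 0 (by simp))
  have hv12 : Vel (gg K q 2 1) (gg K q 2 2) = 0 := by
    simpa [gg, mkAlgHom_Vel] using RingQuot.mkAlgHom_rel K
      (ATLRel.v_sna (K := K) (q := q) (n := 2) le_rfl 1 (by simp))
  have hF0 : F (gg K q 1 0) = gg K q 2 0 := hF.1 0 (by simp)
  have hF1 : F (gg K q 1 1) = gg K q 2 1 * gg K q 2 2 * ggInv K q 2 1 := hF.2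
  have hquad := gg_mul_self K q 2
  have hmark (x : TLhat K q 2) (hx : x ∈ F.range) (ε : ℕ) (hε : ε ≤ 1) :
      x * gg K q 2 1 ^ ε ∈
        traceClosure (Submodule.span K {x : TLhat K q 2 | IsMarkov K q 2 F x}) := by
    obtain ⟨A, rfl⟩ := hx
    refine le_traceClosure _ (Submodule.subset_span ⟨A, 1, ε, hε, ?_⟩)
    rw [map_one, mul_one]
    rfl
  have hmark0 (x : TLhat K q 2) (hx : x ∈ F.range) := by simpa using hmark x hx 0 zero_le_one
  refine mem_of_temperleyLieb (q := q) (isUnit_of_invertible q) (isUnit_of_invertible (q + 1))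
    (a := gg K q 2 0 + 1) (b := gg K q 2 1 + 1) (e := gg K q 2 2 + 1)
    (add_one_mul_self_of_quadratic (hquad 0)) (add_one_mul_self_of_quadratic (hquad 1))
    (add_one_mul_self_of_quadratic (hquad 2))
    (add_one_mul_mul_of_Vel (hquad 0) hv01)
    (add_one_mul_mul_of_Vel (hquad 1) (Vel_comm_of_braid hb01 ▸ hv01))
    (add_one_mul_mul_of_Vel (hquad 0) hv02)
    (add_one_mul_mul_of_Vel (hquad 2) (Vel_comm_of_braid hb02 ▸ hv02))
    (add_one_mul_mul_of_Vel (hquad 1) hv12)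
    (add_one_mul_mul_of_Vel (hquad 2) (Vel_comm_of_braid hb12 ▸ hv12))
    ?_ _ (fun x y => mul_comm_mem_traceClosure _) F.range ?_ ?_ hmark0 ?_ r
  · intro P h1 h
    refine mem_of_gg_mul_mem P h1 fun i x hx => ?_
    obtain ⟨h0, h1, h2⟩ := h x hx
    rw [add_mul, one_mul, P.add_mem_iff_left hx] at h0 h1 h2
    fin_cases i
    exacts [h0, h1, h2]
  · exact add_mem ⟨_, hF0⟩ (one_mem _)
  · convert F.range.smul_mem (add_mem ⟨_, hF1⟩ (one_mem _)) q using 1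
    have h : gg K q 2 1 * gg K q 2 2 * gg K q 2 1 =
        -(gg K q 2 1 * gg K q 2 2 + gg K q 2 2 * gg K q 2 1 + gg K q 2 1 + gg K q 2 2 + 1) := by
      rw [eq_neg_iff_add_eq_zero, ← hv12, Vel]
      abel
    simp only [ggInv, Algebra.algebraMap_eq_smul_one, mul_add, add_mul, mul_sub, mul_smul_comm,
      smul_add, smul_smul, mul_invOf_self, one_smul, mul_one, one_mul, h]
    module
  · intro x hx
    rw [mul_add, mul_one]
    exact add_mem (by simpa using hmark x hx 1 le_rfl) (hmark0 x hx)

/-- Lemma 5.1.7: for `1 ≤ r ≤ s`, every trace `τ_3` on `TL̂_3(q)`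
satisfies `τ_3((g_{σ_1}F(t_{a_2}))^r g_{σ_1} g_{σ_2} (g_{σ_1}F(t_{a_2}))^s g_{σ_1} g_{σ_2})
= τ_3(Σ_{j=0}^{h} c_j Y^j + M)` with `h ≤ s`, `c_j ∈ Im F` and `M` a linear combination
of Markov elements. -/
theorem lemma_5_1_7
    (K : Type*) [CommRing K] [IsDomain K] [CharZero K]
    (q sq : K) [Invertible q] [Invertible (q + 1)] (hsq : sq * sq = q)
    (r s : ℕ) (hr : 1 ≤ r) (hs : 1 ≤ s) (hrs : r ≤ s)
    (F : TLhat K q 1 →ₐ[K] TLhat K q 2) (hF : IsF K q 2 F) :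
    ∃ h ≤ s, ∃ c : ℕ → TLhat K q 2, (∀ j, c j ∈ F.range) ∧
      ∃ M ∈ Submodule.span K {x : TLhat K q 2 | IsMarkov K q 2 F x},
        ∀ τ : TLhat K q 2 →ₗ[K] K, IsTrace K τ →
          τ ((gg K q 2 0 * F (gg K q 1 1)) ^ r * gg K q 2 0 * gg K q 2 1 *
              (gg K q 2 0 * F (gg K q 1 1)) ^ s * gg K q 2 0 * gg K q 2 1) =
          τ ((∑ j ∈ Finset.range (h + 1),
              c j * (gg K q 2 1 * gg K q 2 0 * gg K q 2 2) ^ j) + M) := by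
  obtain ⟨M, hM, h⟩ := mem_traceClosure_span_isMarkov hF
    ((gg K q 2 0 * F (gg K q 1 1)) ^ r * gg K q 2 0 * gg K q 2 1 *
      (gg K q 2 0 * F (gg K q 1 1)) ^ s * gg K q 2 0 * gg K q 2 1)
  exact ⟨0, Nat.zero_le s, 0, fun _ => zero_mem _, M, hM, fun τ hτ => by simpa using h τ hτ⟩
end
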